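/- For every A > 0 and every k ≥ 1 there exist B = B(A,k) > 0 and C = C(A,k,ψ) > 0 with the following property. Let ψ be a polynomial of degree k with integer coefficients and positive leading coefficient a₁, let b ≤ W be positive integers with gcd(b,W) = 1, and let N be a positive integer with N ≥ e^{a₁W^k}. If α ∈ ℝ satisfies |α − a/q| ≤ q^{−2} for some integers a, q with 1 ≤ a ≤ q, gcd(a,q) = 1 and (log N)^B ≤ q ≤ ψ(N)(log N)^{−B}, then | Σ_{x=1}^{N} λ_{b,W}(x) e(α·ψ(x)) | ≤ C·N·(log N)^{−A}. -/

import Mathlib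

open Finset

/-- `e(t) = exp(2πit)`. -/
noncomputable def eC (t : ℝ) : ℂ := Complex.exp (2 * Real.pi * Complex.I * t)

/-- `λ_{b,W}(x) = (φ(W)/W)·log(Wx+b)` if `Wx+b` is prime, and `0` otherwise. -/
noncomputable def lam (b W x : ℕ) : ℝ :=
  if Nat.Prime (W * x + b) then ((Nat.totient W : ℝ) / W) * Real.log (W * x + b) else 0

/-- `x` lies within `ε` of an integer. -/
def NearInt (x ε : ℝ) : Prop := ∃ n : ℤ, |x - n| ≤ ε

lemma NearInt.mono {x ε δ : ℝ} (h : NearInt x ε) (hε : ε ≤ δ) : NearInt x δ :=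
  h.imp fun _ hn => hn.trans hε

lemma NearInt.sub {x y ε δ : ℝ} (hx : NearInt x ε) (hy : NearInt y δ) :
    NearInt (x - y) (ε + δ) := by
  obtain ⟨n, hn⟩ := hx
  obtain ⟨m, hm⟩ := hy
  refine ⟨n - m, ?_⟩
  push_cast
  rw [abs_le] at *
  constructor <;> linarith [hn.1, hn.2, hm.1, hm.2]

lemma NearInt.nonneg {x ε : ℝ} (h : NearInt x ε) : 0 ≤ ε := by
  obtain ⟨n, hn⟩ := h
  exact (abs_nonneg _).trans hn

lemma nearInt_of_one_le (x : ℝ) {ε : ℝ} (h : 1 ≤ ε) : NearInt x ε :=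
  ⟨round x, (abs_sub_round x).trans (by linarith)⟩

lemma NearInt.abs_le_of_small {x ε : ℝ} (h : NearInt x ε) (hx : |x| ≤ 1 / 4) (hε : ε < 3 / 4) :
    |x| ≤ ε := by
  obtain ⟨n, hn⟩ := h
  have h1 : |(n : ℝ)| < 1 := by
    have : (n : ℝ) = x - (x - n) := by ring
    rw [this]
    calc _ ≤ |x| + |x - n| := abs_sub _ _
      _ < 1 := by linarith
  have h2 : n = 0 := by
    have : |n| < 1 := by exact_mod_cast h1
    exact Int.abs_lt_one_iff.mp this
  simpa [h2] using hn

lemma exists_pair_of_residue {T : Finset ℕ} (hT : T.Nonempty) {q r : ℕ}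
    (hr : ∀ h ∈ T, h % q = r) :
    ∃ h ∈ T, ∃ j, h + q * j ∈ T ∧ T.card ≤ j + 1 := by
  have key : ∀ h ∈ T, ∃ i, h = T.min' hT + q * i := by
    intro h hh
    have h1 : T.min' hT ≤ h := T.min'_le h hh
    have h2 : T.min' hT ≡ h [MOD q] := by
      rw [Nat.ModEq, hr _ hh, hr _ (T.min'_mem hT)]
    obtain ⟨i, hi⟩ := (Nat.modEq_iff_dvd' h1).1 h2
    exact ⟨i, by omega⟩
  obtain ⟨j, hj⟩ := key _ (T.max'_mem hT)
  refine ⟨T.min' hT, T.min'_mem hT, j, hj ▸ T.max'_mem hT, ?_⟩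
  have hsub : T ⊆ (range (j + 1)).image (fun i => T.min' hT + q * i) := by
    intro h hh
    obtain ⟨i, hi⟩ := key h hh
    rw [mem_image]
    rcases Nat.lt_or_ge i (j + 1) with hij | hij
    · exact ⟨i, mem_range.2 hij, hi.symm⟩
    · refine ⟨j, by simp, ?_⟩
      have h3 : h ≤ T.max' hT := T.le_max' h hh
      have h4 : q * j ≤ q * i := Nat.mul_le_mul_left _ (by omega)
      omega
  simpa using (card_le_card hsub).trans card_image_le

lemma exists_close_pair {S : Finset ℕ} {H q T : ℕ} (hS : S ⊆ Icc 1 H) (hne : S.Nonempty)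
    (hq : 1 ≤ q) (hT : 1 ≤ T) :
    ∃ h ∈ S, ∃ j, h + q * j ∈ S ∧ j < T ∧ S.card ≤ (j + 1) * (q * (H / (q * T) + 1)) := by
  have hqT : 0 < q * T := Nat.mul_pos hq hT
  set t := range q ×ˢ range (H / (q * T) + 1) with ht
  have hmaps : ∀ h ∈ S, (h % q, h / (q * T)) ∈ t := by
    intro h hh
    have := mem_Icc.1 (hS hh)
    simp only [ht, mem_product, mem_range]
    exact ⟨Nat.mod_lt _ hq, Nat.lt_succ_of_le (Nat.div_le_div_right this.2)⟩
  have hcard : t.card = q * (H / (q * T) + 1) := by simp [ht]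
  have hpos : 0 < t.card := by rw [hcard]; positivity
  obtain ⟨y, -, hy⟩ := exists_le_card_fiber_of_nsmul_le_card_of_maps_to (b := (S.card : ℝ) / t.card)
    hmaps (card_pos.1 hpos) (by
      rw [nsmul_eq_mul]
      have : (0 : ℝ) < t.card := by exact_mod_cast hpos
      field_simp; rfl)
  set T' := S.filter (fun h => (h % q, h / (q * T)) = y) with hT'
  have hpos' : (0 : ℝ) < t.card := by exact_mod_cast hpos
  have hc : S.card ≤ T'.card * t.card := by
    rw [div_le_iff₀ hpos'] at hy
    exact_mod_cast hy
  have hT'ne : T'.Nonempty := by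
    rw [← card_pos]
    have := card_pos.2 hne
    by_contra h
    have : T'.card = 0 := by omega
    rw [this] at hc
    omega
  obtain ⟨h, hh, j, hj, hcj⟩ := exists_pair_of_residue hT'ne (q := q) (r := y.1) (by
    intro h hh
    rw [hT', mem_filter] at hh
    rw [← hh.2])
  rw [hT', mem_filter] at hh hj
  refine ⟨h, hh.1, j, hj.1, ?_, ?_⟩
  · have e : (h + q * j) / (q * T) = h / (q * T) := by
      rw [← hh.2] at hj
      exact (Prod.ext_iff.1 hj.2).2
    by_contra hjT
    have h1 : h + q * T ≤ h + q * j := by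
      have := Nat.mul_le_mul_left q (Nat.le_of_not_lt hjT)
      omega
    have h2 := Nat.div_le_div_right (c := q * T) h1
    rw [Nat.add_div_right _ hqT, e] at h2
    omega
  · rw [← hcard]
    exact hc.trans (Nat.mul_le_mul_right _ hcj)

set_option maxHeartbeats 1000000 in
lemma linear_recurrence {K : ℝ} (hK : 2 ≤ K) {H : ℕ} {S : Finset ℕ} (hS : S ⊆ Icc 1 H)
    (hH : 1 ≤ H) (hcard : (H : ℝ) / K ≤ S.card) {β ε : ℝ} (hβ : ∀ h ∈ S, NearInt (β * h) ε)
    (hε : ε * K ^ 10 ≤ 1) :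
    ∃ q : ℕ, 1 ≤ q ∧ (q : ℝ) ≤ K ^ 10 ∧ NearInt (q * β) (K ^ 10 * ε / H) := by
  have hK0 : (0 : ℝ) < K := by linarith
  have hH0 : (0 : ℝ) < H := by exact_mod_cast hH
  have hne : S.Nonempty := by
    rw [← card_pos]
    have : (0 : ℝ) < S.card := lt_of_lt_of_le (by positivity) hcard
    exact_mod_cast this
  have hε0 : 0 ≤ ε := by
    obtain ⟨h, hh⟩ := hne
    exact (hβ h hh).nonneg
  have hK2 : 4 ≤ K ^ 2 := by nlinarith
  have hK8 : 256 ≤ K ^ 8 := by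
    calc (256 : ℝ) = 2 ^ 8 := by norm_num
      _ ≤ K ^ 8 := by gcongr
  have hK10 : 256 * K ^ 2 ≤ K ^ 10 := by
    calc 256 * K ^ 2 ≤ K ^ 8 * K ^ 2 := by gcongr
      _ = K ^ 10 := by ring
  have hεs : ε * (256 * K ^ 2) ≤ 1 := le_trans (by gcongr) hε
  have hεs' : ε ≤ 1 / 1024 := by nlinarith
  rcases lt_or_ge (H : ℝ) (16 * K ^ 2) with hsmall | hlarge
  · obtain ⟨h, hh⟩ := hne
    have hh' := mem_Icc.1 (hS hh)
    have hhH : (h : ℝ) ≤ H := by exact_mod_cast hh'.2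
    refine ⟨h, hh'.1, by nlinarith, ?_⟩
    have := hβ h hh
    rw [mul_comm] at this
    refine this.mono ?_
    rw [le_div_iff₀ hH0, mul_comm]
    gcongr
    nlinarith
  have hT1 : 1 ≤ ⌊4 * K⌋₊ := Nat.le_floor (by push_cast; linarith)
  obtain ⟨h, hh, q, hq, hqT, hqc⟩ := exists_close_pair hS hne le_rfl hT1
  have hT1r : 4 * K - 1 < (⌊4 * K⌋₊ : ℝ) := Nat.sub_one_lt_floor _
  have hT1r' : (⌊4 * K⌋₊ : ℝ) ≤ 4 * K := Nat.floor_le (by positivity)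
  have hq1 : 1 ≤ q := by
    by_contra hq0
    have hq0 : q = 0 := by omega
    subst hq0
    have h1 : (S.card : ℝ) ≤ H / (⌊4 * K⌋₊ : ℝ) + 1 := by
      calc (S.card : ℝ) ≤ ((H / ⌊4 * K⌋₊ + 1 : ℕ) : ℝ) := by
            exact_mod_cast (by simpa using hqc)
        _ ≤ _ := by push_cast; gcongr; exact Nat.cast_div_le
    have h2 : (H : ℝ) / ⌊4 * K⌋₊ ≤ H / (2 * K) := by
      gcongr; linarith
    have h3 : (H : ℝ) / K ≤ H / (2 * K) + 1 := by linarith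
    have h4 : (H : ℝ) / K = 2 * (H / (2 * K)) := by field_simp
    have h5 : (H : ℝ) / (2 * K) ≤ 1 := by linarith
    rw [div_le_one (by positivity)] at h5
    nlinarith
  have hqK : (q : ℝ) ≤ 4 * K := by
    have : (q : ℝ) ≤ ⌊4 * K⌋₊ := by exact_mod_cast hqT.le
    linarith
  have hqβ : NearInt (q * β) (2 * ε) := by
    have := (hβ _ hq).sub (hβ _ hh)
    refine (by convert this using 1; push_cast; ring : NearInt (q * β) (ε + ε)).mono (by linarith)
  obtain ⟨a, ha⟩ := hqβ
  set θ := q * β - a with hθ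
  have hq0 : (0 : ℝ) < q := by exact_mod_cast hq1
  have claim : ∀ T : ℕ, 1 ≤ T → T ≤ H → |θ| * T ≤ 1 / 4 →
      |θ| * (T / (5 * K ^ 2) - 1) ≤ 2 * ε := by
    intro T hT hTH hθT
    obtain ⟨h, hh, j, hj, hjT, hjc⟩ := exists_close_pair hS hne hq1 hT
    have hT0 : (0 : ℝ) < T := by exact_mod_cast hT
    have hjT' : (j : ℝ) ≤ T := by exact_mod_cast hjT.le
    have h1 : NearInt (θ * j) (2 * ε) := by
      obtain ⟨n, hn⟩ := (hβ _ hj).sub (hβ _ hh)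
      refine ⟨n - a * j, ?_⟩
      have e : θ * j - ((n - a * j : ℤ) : ℝ) = β * ((h + q * j : ℕ) : ℝ) - β * h - n := by
        push_cast; rw [hθ]; ring
      rw [e]
      linarith
    have h2 : |θ * j| ≤ 2 * ε := by
      refine h1.abs_le_of_small ?_ (by linarith)
      rw [abs_mul, Nat.abs_cast]
      calc |θ| * j ≤ |θ| * T := by gcongr
        _ ≤ _ := hθT
    rw [abs_mul, Nat.abs_cast] at h2
    have h3 : (T : ℝ) / (5 * K ^ 2) - 1 ≤ j := by
      have c1 : (S.card : ℝ) ≤ (j + 1) * (q * (H / (q * T) + 1)) := by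
        calc (S.card : ℝ) ≤ (((j + 1) * (q * (H / (q * T) + 1)) : ℕ) : ℝ) := by exact_mod_cast hjc
          _ ≤ _ := by
            push_cast
            gcongr
            calc (((H / (q * T) : ℕ)) : ℝ) ≤ (H : ℝ) / ((q * T : ℕ) : ℝ) := Nat.cast_div_le
              _ = _ := by push_cast; rfl
      have c2 : (q : ℝ) * (H / (q * T) + 1) ≤ 5 * K * (H / T) := by
        have e : (q : ℝ) * (H / (q * T) + 1) = H / T + q := by field_simp
        have : (1 : ℝ) ≤ H / T := by
          rw [one_le_div hT0]; exact_mod_cast hTH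
        rw [e]
        nlinarith
      have c3 : (H : ℝ) / K ≤ (j + 1) * (5 * K * (H / T)) :=
        hcard.trans (c1.trans (by gcongr))
      rw [div_le_iff₀ hK0] at c3
      have c4 : (H : ℝ) * T ≤ (j + 1) * (5 * K ^ 2) * H := by
        have : (j + 1 : ℝ) * (5 * K * (H / T)) * K * T = (j + 1) * (5 * K ^ 2) * H := by
          field_simp
        rw [← this]
        gcongr
      have c5 : (T : ℝ) ≤ (j + 1) * (5 * K ^ 2) := by
        nlinarith
      rw [sub_le_iff_le_add, div_le_iff₀ (by positivity)]
      exact c5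
    calc |θ| * (T / (5 * K ^ 2) - 1) ≤ |θ| * j := by gcongr
      _ ≤ _ := h2
  refine ⟨q, hq1, by nlinarith, a, ?_⟩
  rw [← hθ]
  rcases le_or_gt (|θ| * H) (1 / 4) with hA | hB
  · have h1 := claim H hH le_rfl hA
    have h2 : (H : ℝ) / (10 * K ^ 2) ≤ H / (5 * K ^ 2) - 1 := by
      have e : (H : ℝ) / (5 * K ^ 2) = 2 * (H / (10 * K ^ 2)) := by field_simp; norm_num
      have : 1 ≤ (H : ℝ) / (10 * K ^ 2) := by
        rw [one_le_div (by positivity)]; nlinarith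
      linarith
    have h3 : |θ| * (H / (10 * K ^ 2)) ≤ 2 * ε := le_trans (by gcongr) h1
    rw [le_div_iff₀ hH0]
    have h4 : |θ| * H = |θ| * (H / (10 * K ^ 2)) * (10 * K ^ 2) := by field_simp
    rw [h4]
    calc |θ| * (H / (10 * K ^ 2)) * (10 * K ^ 2) ≤ 2 * ε * (10 * K ^ 2) := by gcongr
      _ ≤ K ^ 10 * ε := by nlinarith
  · exfalso
    have hθ0 : 0 < |θ| := by
      by_contra h
      have : |θ| = 0 := le_antisymm (not_lt.1 h) (abs_nonneg _)
      rw [this] at hB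
      norm_num at hB
    set T := ⌊1 / (4 * |θ|)⌋₊ with hT
    have hθs : |θ| ≤ 1 / 512 := by linarith
    have hx1 : 1 ≤ 1 / (4 * |θ|) := by
      rw [one_le_div (by positivity)]; linarith
    have hT1 : 1 ≤ T := Nat.le_floor (by simpa using hx1)
    have hTx : (T : ℝ) ≤ 1 / (4 * |θ|) := Nat.floor_le (by positivity)
    have hxT : 1 / (4 * |θ|) < T + 1 := Nat.lt_floor_add_one _
    have hθT : |θ| * T ≤ 1 / 4 := by
      rw [le_div_iff₀ (by positivity)] at hTx
      linarith
    have hθT' : 1 / 8 ≤ |θ| * T := by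
      rw [div_lt_iff₀ (by positivity)] at hxT
      nlinarith
    have hTH : T ≤ H := by
      have : (T : ℝ) ≤ H := by
        by_contra h
        push Not at h
        nlinarith
      exact_mod_cast this
    have h1 := claim T hT1 hTH hθT
    have h2 : |θ| * T / (5 * K ^ 2) ≤ 4 * ε := by
      have : |θ| * (T / (5 * K ^ 2) - 1) = |θ| * T / (5 * K ^ 2) - |θ| := by ring
      linarith
    rw [div_le_iff₀ (by positivity)] at h2
    nlinarith

lemma exists_common_value {K : ℝ} (hK : 2 ≤ K) {ι : Type*} {S : Finset ι} {B : ℝ}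
    (hcard : B / K ≤ S.card) {f : ι → ℕ} (hf : ∀ h ∈ S, 1 ≤ f h ∧ (f h : ℝ) ≤ K) :
    ∃ q : ℕ, 1 ≤ q ∧ (q : ℝ) ≤ K ∧ B / K ^ 2 ≤ (S.filter (fun h => f h = q)).card := by
  have hK0 : (0 : ℝ) < K := by linarith
  have hf1 : 1 ≤ ⌊K⌋₊ := Nat.le_floor (by push_cast; linarith)
  obtain ⟨q, hq, hqc⟩ := exists_le_card_fiber_of_nsmul_le_card_of_maps_to (s := S)
    (t := Icc 1 ⌊K⌋₊) (f := f) (b := (S.card : ℝ) / ⌊K⌋₊)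
    (fun h hh => mem_Icc.2 ⟨(hf h hh).1, Nat.le_floor (hf h hh).2⟩) ⟨1, by simp [hf1]⟩ (by
      have : (0 : ℝ) < ⌊K⌋₊ := by exact_mod_cast hf1
      rw [nsmul_eq_mul]
      simp only [Nat.card_Icc, Nat.add_sub_cancel]
      field_simp; rfl)
  have h1 := mem_Icc.1 hq
  have hfl : (⌊K⌋₊ : ℝ) ≤ K := Nat.floor_le hK0.le
  refine ⟨q, h1.1, le_trans (by exact_mod_cast h1.2) hfl, le_trans ?_ hqc⟩
  have h0 : (0 : ℝ) < ⌊K⌋₊ := by exact_mod_cast hf1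
  calc B / K ^ 2 = (B / K) / K := by field_simp
    _ ≤ S.card / K := by gcongr
    _ ≤ S.card / ⌊K⌋₊ := by gcongr

lemma linear_recurrence_var {K : ℝ} (hK : 2 ≤ K) {H : ℕ} {S : Finset ℕ} (hS : S ⊆ Icc 1 H)
    (hH : 1 ≤ H) (hcard : (H : ℝ) / K ≤ S.card) {β ε : ℝ}
    (hβ : ∀ h ∈ S, ∃ q : ℕ, 1 ≤ q ∧ (q : ℝ) ≤ K ∧ NearInt (q * (β * h)) ε)
    (hε : ε * K ^ 21 ≤ 1) :
    ∃ q : ℕ, 1 ≤ q ∧ (q : ℝ) ≤ K ^ 21 ∧ NearInt (q * β) (K ^ 21 * ε / H) := by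
  have hK0 : (0 : ℝ) < K := by linarith
  have hH0 : (0 : ℝ) < H := by exact_mod_cast hH
  have hε0 : 0 ≤ ε := by
    have hne : S.Nonempty := by
      rw [← card_pos]
      have : (0 : ℝ) < S.card := lt_of_lt_of_le (by positivity) hcard
      exact_mod_cast this
    obtain ⟨h, hh⟩ := hne
    obtain ⟨q, -, -, hq⟩ := hβ h hh
    exact hq.nonneg
  choose! f hf1 hf2 hf3 using hβ
  obtain ⟨q, hq1, hqK, hqc⟩ := exists_common_value hK hcard (f := f)
    (fun h hh => ⟨hf1 h hh, hf2 h hh⟩)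
  have hpow : (K ^ 2) ^ 10 ≤ K ^ 21 := by
    rw [← pow_mul]
    exact pow_le_pow_right₀ (by linarith) (by norm_num)
  obtain ⟨q', hq'1, hq'K, hq'⟩ := linear_recurrence (K := K ^ 2) (by nlinarith)
    (S := S.filter (fun h => f h = q)) ((filter_subset _ _).trans hS) hH hqc (β := q * β) (ε := ε)
    (by
      intro h hh
      rw [mem_filter] at hh
      have := hf3 h hh.1
      rw [hh.2] at this
      rwa [mul_assoc])
    (le_trans (by gcongr) hε)
  refine ⟨q' * q, Nat.mul_pos hq'1 hq1, ?_, ?_⟩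
  · push_cast
    calc (q' : ℝ) * q ≤ (K ^ 2) ^ 10 * K := by gcongr
      _ = K ^ 21 := by ring
  · push_cast
    rw [mul_assoc]
    refine hq'.mono ?_
    gcongr

/-- `f` behaves under `k`-fold differencing like a polynomial of degree at most `k`: its `k`-th
differences with steps `h₁, …, h_k` are constant, equal to `β h₁ ⋯ h_k`. -/
def PolyPhase : ℕ → ℝ → (ℝ → ℝ) → Prop
  | 0, β, f => ∀ x, f x = β
  | k + 1, β, f => ∀ h : ℝ, PolyPhase k (β * h) (fun x => f (x + h) - f x)

lemma PolyPhase.sub {k : ℕ} {β γ : ℝ} {f g : ℝ → ℝ} (hf : PolyPhase k β f)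
    (hg : PolyPhase k γ g) : PolyPhase k (β - γ) (fun x => f x - g x) := by
  induction k generalizing β γ f g with
  | zero => intro x; simp only [hf x, hg x]
  | succ k ih =>
    intro h
    have := ih (hf h) (hg h)
    convert this using 1
    · ring
    · ext x; ring

lemma PolyPhase.const_mul {k : ℕ} {β : ℝ} {f : ℝ → ℝ} (hf : PolyPhase k β f) (c : ℝ) :
    PolyPhase k (c * β) (fun x => c * f x) := by
  induction k generalizing β f with
  | zero => intro x; simp only [hf x]
  | succ k ih =>
    intro h
    have := ih (hf h)
    convert this using 1
    · ring
    · ext x; ring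

lemma PolyPhase.comp_affine {k : ℕ} {β : ℝ} {f : ℝ → ℝ} (hf : PolyPhase k β f) (a b : ℝ) :
    PolyPhase k (β * a ^ k) (fun x => f (a * x + b)) := by
  induction k generalizing β f with
  | zero => intro x; simp [hf (a * x + b)]
  | succ k ih =>
    intro h
    have := ih (hf (a * h))
    convert this using 1
    · ring
    · ext x; congr 2; ring_nf

lemma polyPhase_zero (k : ℕ) : PolyPhase k 0 (fun _ => 0) := by
  induction k with
  | zero => intro x; rfl
  | succ k ih => intro h; simpa using ih

lemma polyPhase_const (k : ℕ) (c : ℝ) : PolyPhase (k + 1) 0 (fun _ => c) := by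
  intro h
  simpa using polyPhase_zero k

lemma polyPhase_eval (k : ℕ) (P : Polynomial ℝ) (hP : P.natDegree ≤ k) :
    PolyPhase k (k.factorial * P.coeff k) (fun x => P.eval x) := by
  induction k generalizing P with
  | zero =>
    intro x
    rw [Polynomial.eq_C_of_natDegree_le_zero hP]
    simp
  | succ k ih =>
    intro h
    have hcoeff : ∀ i, k + 1 ≤ i → (Polynomial.taylor h P).coeff i = P.coeff i := by
      intro i hi
      have h1 : (Polynomial.hasseDeriv i P).natDegree ≤ 0 :=
        (Polynomial.natDegree_hasseDeriv_le P i).trans (by omega)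
      rw [Polynomial.taylor_coeff, Polynomial.eq_C_of_natDegree_le_zero h1,
        Polynomial.hasseDeriv_coeff]
      simp
    have hk : (Polynomial.taylor h P).coeff k = (k + 1) * P.coeff (k + 1) * h + P.coeff k := by
      have h1 : (Polynomial.hasseDeriv k P).natDegree ≤ 1 :=
        (Polynomial.natDegree_hasseDeriv_le P k).trans (by omega)
      rw [Polynomial.taylor_coeff, Polynomial.eq_X_add_C_of_natDegree_le_one h1,
        Polynomial.hasseDeriv_coeff, Polynomial.hasseDeriv_coeff]
      have : (1 + k).choose k = k + 1 := by rw [add_comm, Nat.choose_succ_self_right]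
      simp [add_comm]
    have h2 := ih (Polynomial.taylor h P - P) (by
      rw [Polynomial.natDegree_le_iff_coeff_eq_zero]
      intro i hi
      rw [Polynomial.coeff_sub, hcoeff i hi, sub_self])
    convert h2 using 1
    · rw [Polynomial.coeff_sub, hk, Nat.factorial_succ]
      push_cast
      ring
    · ext x
      simp [Polynomial.taylor_eval]

lemma polyPhase_pow (k : ℕ) : PolyPhase k k.factorial (fun x => x ^ k) := by
  have := polyPhase_eval k (Polynomial.X ^ k) (Polynomial.natDegree_X_pow_le k)
  simpa using this

lemma norm_eC (t : ℝ) : ‖eC t‖ = 1 := by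
  have : eC t = Complex.exp ((2 * Real.pi * t : ℝ) * Complex.I) := by
    unfold eC; congr 1; push_cast; ring
  rw [this, Complex.norm_exp_ofReal_mul_I]

lemma eC_add (s t : ℝ) : eC (s + t) = eC s * eC t := by
  unfold eC
  rw [← Complex.exp_add]
  congr 1; push_cast; ring

lemma conj_eC (t : ℝ) : (starRingEnd ℂ) (eC t) = eC (-t) := by
  unfold eC
  rw [← Complex.exp_conj]
  congr 1
  simp only [map_mul, Complex.conj_ofReal, Complex.conj_I, map_ofNat, Complex.ofReal_neg]
  ring

lemma eC_mul_conj (s t : ℝ) : eC s * (starRingEnd ℂ) (eC t) = eC (s - t) := by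
  rw [conj_eC, ← eC_add, sub_eq_add_neg]

lemma eC_int (n : ℤ) : eC n = 1 := by
  unfold eC
  rw [← Complex.exp_int_mul_two_pi_mul_I n]
  congr 1; push_cast; ring

lemma nearInt_of_norm_eC_sub_one {β δ : ℝ} (h : ‖eC β - 1‖ ≤ δ) : NearInt β (δ / 4) := by
  refine ⟨round β, ?_⟩
  set θ := β - round β with hθ
  have h1 : eC β = eC θ := by
    have : β = θ + (round β : ℤ) := by rw [hθ]; ring
    conv_lhs => rw [this]
    rw [eC_add, eC_int, mul_one]
  have h2 : eC θ = Complex.exp (Complex.I * (2 * Real.pi * θ : ℝ)) := by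
    unfold eC; congr 1; push_cast; ring
  rw [h1, h2, Complex.norm_exp_I_mul_ofReal_sub_one, norm_mul, Real.norm_eq_abs, Real.norm_eq_abs,
    abs_two] at h
  have hθ2 : |θ| ≤ 1 / 2 := abs_sub_round β
  have h3 : |2 * Real.pi * θ / 2| = Real.pi * |θ| := by
    rw [show 2 * Real.pi * θ / 2 = Real.pi * θ by ring, abs_mul, abs_of_pos Real.pi_pos]
  have h4 := Real.mul_abs_le_abs_sin (x := 2 * Real.pi * θ / 2) (by
    rw [h3]; nlinarith [Real.pi_pos])
  rw [h3] at h4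
  have h5 : 2 / Real.pi * (Real.pi * |θ|) = 2 * |θ| := by
    field_simp
  linarith

lemma vanDerCorput (s : Finset ℕ) (H : ℕ) (hs : ∀ m ∈ s, ∀ n ∈ s, n ≤ m + H) (g : ℕ → ℂ) :
    ‖∑ n ∈ s, g n‖ ^ 2 ≤ ∑ n ∈ s, ‖g n‖ ^ 2 + 2 * ∑ h ∈ Icc 1 H,
      ‖∑ n ∈ s.filter (fun n => n + h ∈ s), g (n + h) * (starRingEnd ℂ) (g n)‖ := by
  set c := starRingEnd ℂ
  set F : ℕ × ℕ → ℂ := fun p => g p.1 * c (g p.2) with hF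
  set A := ∑ p ∈ (s ×ˢ s).filter (fun p => p.2 < p.1), F p with hA
  have hnorm : ‖∑ n ∈ s, g n‖ ^ 2 = ‖∑ p ∈ s ×ˢ s, F p‖ := by
    have : ∑ p ∈ s ×ˢ s, F p = (∑ n ∈ s, g n) * c (∑ n ∈ s, g n) := by
      rw [map_sum, sum_mul_sum, sum_product]
    rw [this, norm_mul, RCLike.norm_conj, sq]
  have hsplit : ∑ p ∈ s ×ˢ s, F p = A + ((∑ p ∈ (s ×ˢ s).filter (fun p => p.1 < p.2), F p)
      + ∑ p ∈ (s ×ˢ s).filter (fun p => p.1 = p.2), F p) := by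
    rw [← sum_filter_add_sum_filter_not (s ×ˢ s) (fun p => p.2 < p.1) F]
    congr 1
    rw [← sum_filter_add_sum_filter_not ((s ×ˢ s).filter _) (fun p => p.1 < p.2) F]
    congr 1
    · rw [filter_filter]
      congr 1
      ext p; simp only [mem_filter]; constructor
      · rintro ⟨h1, h2, h3⟩; exact ⟨h1, h3⟩
      · rintro ⟨h1, h2⟩; exact ⟨h1, by omega, h2⟩
    · rw [filter_filter]
      congr 1
      ext p; simp only [mem_filter]; constructor
      · rintro ⟨h1, h2, h3⟩; exact ⟨h1, by omega⟩
      · rintro ⟨h1, h2⟩; exact ⟨h1, by omega, by omega⟩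
  have hconj : ∑ p ∈ (s ×ˢ s).filter (fun p => p.1 < p.2), F p = c A := by
    rw [hA, map_sum]
    refine sum_nbij' Prod.swap Prod.swap ?_ ?_ ?_ ?_ ?_
    · rintro ⟨a, b⟩; simp only [mem_filter, mem_product, Prod.swap]; tauto
    · rintro ⟨a, b⟩; simp only [mem_filter, mem_product, Prod.swap]; tauto
    · simp
    · simp
    · rintro ⟨a, b⟩ _
      simp [hF, c, mul_comm]
  have hdiag : ∑ p ∈ (s ×ˢ s).filter (fun p => p.1 = p.2), F p
      = ((∑ n ∈ s, ‖g n‖ ^ 2 : ℝ) : ℂ) := by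
    push_cast
    refine sum_nbij' Prod.fst (fun n => (n, n)) ?_ ?_ ?_ ?_ ?_
    · rintro ⟨a, b⟩; simp only [mem_filter, mem_product]; tauto
    · intro n hn; simp [hn]
    · rintro ⟨a, b⟩; simp only [mem_filter, mem_product]; rintro ⟨-, rfl⟩; rfl
    · simp
    · rintro ⟨a, b⟩; simp only [mem_filter, mem_product]; rintro ⟨-, rfl⟩
      simp only [hF, c]
      rw [Complex.mul_conj, Complex.normSq_eq_norm_sq]; push_cast; rfl
  have hAh : A = ∑ h ∈ Icc 1 H, ∑ n ∈ s.filter (fun n => n + h ∈ s), g (n + h) * c (g n) := by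
    rw [hA, ← sum_fiberwise_of_maps_to (t := Icc 1 H) (g := fun p : ℕ × ℕ => p.1 - p.2)]
    · refine sum_congr rfl fun h hh => ?_
      rw [mem_Icc] at hh
      refine sum_nbij' Prod.snd (fun n => (n + h, n)) ?_ ?_ ?_ ?_ ?_
      · rintro ⟨a, b⟩; simp only [mem_filter, mem_product]
        rintro ⟨⟨⟨ha, hb⟩, hab⟩, rfl⟩
        exact ⟨hb, by rwa [Nat.add_sub_cancel' hab.le]⟩
      · intro n hn; simp only [mem_filter, mem_product] at hn ⊢
        exact ⟨⟨⟨hn.2, hn.1⟩, by omega⟩, by omega⟩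
      · rintro ⟨a, b⟩; simp only [mem_filter, mem_product]
        rintro ⟨⟨⟨ha, hb⟩, hab⟩, rfl⟩
        rw [Nat.add_sub_cancel' hab.le]
      · simp
      · rintro ⟨a, b⟩; simp only [mem_filter, mem_product]
        rintro ⟨⟨⟨ha, hb⟩, hab⟩, rfl⟩
        simp only [hF]
        rw [Nat.add_sub_cancel' hab.le]
    · rintro ⟨a, b⟩; simp only [mem_filter, mem_product, mem_Icc]
      rintro ⟨⟨ha, hb⟩, hab⟩
      have := hs b hb a ha
      omega
  have hAn : ‖A‖ ≤ ∑ h ∈ Icc 1 H,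
      ‖∑ n ∈ s.filter (fun n => n + h ∈ s), g (n + h) * c (g n)‖ := by
    rw [hAh]; exact norm_sum_le _ _
  rw [hnorm, hsplit, hconj, hdiag]
  have h1 : ‖((∑ n ∈ s, ‖g n‖ ^ 2 : ℝ) : ℂ)‖ = ∑ n ∈ s, ‖g n‖ ^ 2 := by
    rw [Complex.norm_real, Real.norm_eq_abs, abs_of_nonneg]
    exact sum_nonneg fun _ _ => by positivity
  calc _ ≤ ‖A‖ + (‖c A‖ + _) := (norm_add_le _ _).trans (by gcongr; exact norm_add_le _ _)
    _ ≤ _ := by rw [h1, RCLike.norm_conj]; linarith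

lemma exists_popular {ι : Type*} {s : Finset ι} {f : ι → ℝ} {n B K : ℝ} (hK : 0 < K) (hB : 0 < B)
    (hn : (s.card : ℝ) ≤ n) (hf : ∀ i ∈ s, f i ≤ B) (hsum : n * B / K ≤ ∑ i ∈ s, f i) :
    n / (2 * K) ≤ (s.filter (fun i => B / (2 * K) ≤ f i)).card := by
  classical
  rw [← sum_filter_add_sum_filter_not s (fun i => B / (2 * K) ≤ f i)] at hsum
  have h1 : ∑ i ∈ s.filter (fun i => B / (2 * K) ≤ f i), f i
      ≤ (s.filter (fun i => B / (2 * K) ≤ f i)).card * B := by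
    rw [← nsmul_eq_mul]
    exact sum_le_card_nsmul _ _ _ fun i hi => hf i (mem_filter.1 hi).1
  have h2 : ∑ i ∈ s.filter (fun i => ¬ B / (2 * K) ≤ f i), f i ≤ n * (B / (2 * K)) := by
    calc _ ≤ ((s.filter (fun i => ¬ B / (2 * K) ≤ f i)).card : ℝ) * (B / (2 * K)) := by
          rw [← nsmul_eq_mul]
          exact sum_le_card_nsmul _ _ _ fun i hi => (not_le.1 (mem_filter.1 hi).2).le
      _ ≤ n * (B / (2 * K)) := by
          gcongr
          exact le_trans (by exact_mod_cast card_filter_le _ _) hn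
  have h3 : n * B / K = n / (2 * K) * B + n * (B / (2 * K)) := by field_simp; norm_num
  nlinarith

lemma eight_sq_le {K : ℝ} (hK : 2 ≤ K) : 8 * K ^ 2 ≤ K ^ 5 := by
  have : (8 : ℝ) ≤ K ^ 3 := by
    calc (8 : ℝ) = 2 ^ 3 := by norm_num
      _ ≤ K ^ 3 := by gcongr
  calc 8 * K ^ 2 ≤ K ^ 3 * K ^ 2 := by gcongr
    _ = K ^ 5 := by ring

lemma weyl_linear {K : ℝ} (hK : 2 ≤ K) {β : ℝ} {f : ℝ → ℝ} (hf : PolyPhase 1 β f) {Y u v : ℕ}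
    (hY : 1 ≤ Y) (hS : (Y : ℝ) / K ≤ ‖∑ y ∈ Ico u v, eC (f y)‖) :
    NearInt β (K / Y) := by
  have hK0 : (0 : ℝ) < K := by linarith
  have hY0 : (0 : ℝ) < Y := by exact_mod_cast hY
  have hstep : ∀ y : ℕ, eC (f (y + 1 : ℕ)) = eC β * eC (f y) := by
    intro y
    rw [← eC_add]
    congr 1
    have : f (y + 1) - f y = β * 1 := hf 1 y
    push_cast; linarith
  rcases lt_or_ge v u with huv | huv
  · rw [Ico_eq_empty (by omega)] at hS
    have : 0 < (Y : ℝ) / K := by positivity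
    simp at hS
    linarith
  have htel : (eC β - 1) * ∑ y ∈ Ico u v, eC (f y) = eC (f v) - eC (f u) := by
    clear hS
    induction v, huv using Nat.le_induction with
    | base => simp
    | succ v huv ih => rw [sum_Ico_succ_top huv, mul_add, ih, hstep]; ring
  have h2 : ‖eC β - 1‖ * ‖∑ y ∈ Ico u v, eC (f y)‖ ≤ 2 := by
    rw [← norm_mul, htel]
    refine (norm_sub_le _ _).trans ?_
    rw [norm_eC, norm_eC]; norm_num
  have h3 : ‖eC β - 1‖ ≤ 2 * K / Y := by
    rw [le_div_iff₀ hY0]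
    have : ‖eC β - 1‖ * (Y / K) ≤ 2 := le_trans (by gcongr) h2
    have e : ‖eC β - 1‖ * Y = ‖eC β - 1‖ * (Y / K) * K := by field_simp
    rw [e]
    gcongr
  refine (nearInt_of_norm_eC_sub_one h3).mono ?_
  rw [div_div, div_le_div_iff₀ (by positivity) hY0]
  nlinarith [mul_pos hK0 hY0]

/-- Weyl's inequality in inverse form: a polynomial exponential sum of degree `k + 1` that is not
small forces its leading coefficient to be close to a rational with small denominator. -/
theorem weyl_inverse (k : ℕ) : ∃ C : ℕ, ∀ K : ℝ, 2 ≤ K → ∀ (β : ℝ) (f : ℝ → ℝ),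
    PolyPhase (k + 1) β f → ∀ Y u v : ℕ, 1 ≤ Y → v ≤ u + Y →
    (Y : ℝ) / K ≤ ‖∑ y ∈ Ico u v, eC (f y)‖ →
    ∃ q : ℕ, 1 ≤ q ∧ (q : ℝ) ≤ K ^ C ∧ NearInt (q * β) (K ^ C / Y ^ (k + 1)) := by
  induction k with
  | zero =>
    refine ⟨1, fun K hK β f hf Y u v hY _ hS => ⟨1, le_rfl, by norm_num; linarith, ?_⟩⟩
    simpa using weyl_linear hK hf hY hS
  | succ k ih =>
    obtain ⟨C, hC⟩ := ih
    set E := 5 * C + 21 * (5 * C + 5) with hE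
    refine ⟨E * (k + 2), fun K hK β f hf Y u v hY huv hS => ?_⟩
    have hK0 : (0 : ℝ) < K := by linarith
    have hK1 : (1 : ℝ) ≤ K := by linarith
    have hY0 : (0 : ℝ) < Y := by exact_mod_cast hY
    rcases lt_or_ge (Y : ℝ) (K ^ E) with hsm | hlg
    · refine ⟨1, le_rfl, by exact_mod_cast one_le_pow₀ hK1, nearInt_of_one_le _ ?_⟩
      rw [one_le_div (by positivity), pow_mul]
      gcongr
    set a : ℕ → ℝ := fun h => ‖∑ n ∈ (Ico u v).filter (fun n => n + h ∈ Ico u v),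
      eC (f (n + h : ℕ)) * (starRingEnd ℂ) (eC (f n))‖ with ha
    have hvdc := vanDerCorput (Ico u v) Y (by
      intro m hm n hn
      rw [mem_Ico] at hm hn
      omega) (fun n => eC (f n))
    have hcardI : ((Ico u v).card : ℝ) ≤ Y := by
      rw [Nat.card_Ico]; exact_mod_cast (by omega : v - u ≤ Y)
    have ha_le : ∀ h ∈ Icc 1 Y, a h ≤ Y := by
      intro h _
      refine (norm_sum_le _ _).trans ?_
      simp only [norm_mul, norm_eC, RCLike.norm_conj, mul_one, sum_const, nsmul_eq_mul]
      exact le_trans (by exact_mod_cast card_filter_le _ _) hcardI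
    have hYK : 4 * K ^ 2 ≤ Y := by
      have : K ^ 5 ≤ K ^ E := pow_le_pow_right₀ hK1 (by omega)
      have := eight_sq_le hK
      nlinarith
    have hsum : (Y : ℝ) * Y / (4 * K ^ 2) ≤ ∑ h ∈ Icc 1 Y, a h := by
      have h1 : ∑ n ∈ Ico u v, ‖eC (f n)‖ ^ 2 ≤ Y := by
        simpa [norm_eC] using hcardI
      have h2 : ((Y : ℝ) / K) ^ 2 ≤ ‖∑ y ∈ Ico u v, eC (f y)‖ ^ 2 := by gcongr
      have h3 : ((Y : ℝ) / K) ^ 2 ≤ Y + 2 * ∑ h ∈ Icc 1 Y, a h := by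
        simp only [ha]; linarith
      have h4 : (Y : ℝ) ≤ Y * Y / (4 * K ^ 2) := by
        rw [le_div_iff₀ (by positivity)]; gcongr
      have h5 : ((Y : ℝ) / K) ^ 2 = 4 * (Y * Y / (4 * K ^ 2)) := by field_simp
      linarith
    have hpop := exists_popular (s := Icc 1 Y) (by positivity) hY0 (by simp) ha_le hsum
    set S := (Icc 1 Y).filter (fun i => (Y : ℝ) / (2 * (4 * K ^ 2)) ≤ a i) with hSdef
    have hY8 : ∀ e : ℕ, 5 ≤ e → (Y : ℝ) / K ^ e ≤ Y / (2 * (4 * K ^ 2)) := by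
      intro e he
      have : K ^ 5 ≤ K ^ e := pow_le_pow_right₀ hK1 he
      have := eight_sq_le hK
      gcongr
      linarith
    have hrec : ∀ h ∈ S, ∃ q : ℕ, 1 ≤ q ∧ (q : ℝ) ≤ K ^ (5 * C + 5) ∧
        NearInt (q * (β * h)) (K ^ (5 * C) / Y ^ (k + 1)) := by
      intro h hh
      rw [hSdef, mem_filter] at hh
      have hfilter : (Ico u v).filter (fun n => n + h ∈ Ico u v) = Ico u (v - h) := by
        ext n; simp only [mem_filter, mem_Ico]; omega
      have h1 : (Y : ℝ) / K ^ 5 ≤ ‖∑ y ∈ Ico u (v - h), eC (f (y + h) - f y)‖ := by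
        refine ((hY8 5 le_rfl).trans hh.2).trans (le_of_eq ?_)
        simp only [ha, hfilter, eC_mul_conj]
        push_cast; rfl
      obtain ⟨q, hq1, hq2, hq3⟩ := hC (K ^ 5) (hK.trans (le_self_pow₀ hK1 (by norm_num)))
        (β * h) _ (hf h) Y u (v - h) hY (by omega) h1
      rw [← pow_mul] at hq2 hq3
      exact ⟨q, hq1, hq2.trans (pow_le_pow_right₀ hK1 (by omega)), hq3⟩
    have hY1 : K ^ E ≤ (Y : ℝ) ^ (k + 1) :=
      hlg.trans (le_self_pow₀ (by exact_mod_cast hY) (by omega))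
    obtain ⟨q, hq1, hq2, hq3⟩ := linear_recurrence_var (K := K ^ (5 * C + 5))
      (hK.trans (le_self_pow₀ hK1 (by omega))) (S := S) (filter_subset _ _) hY
      ((hY8 _ (by omega)).trans (le_trans (by
        rw [div_le_div_iff_of_pos_right (by positivity)]) hpop)) hrec (by
        rw [div_mul_eq_mul_div, div_le_one (by positivity), ← pow_mul, ← pow_add]
        refine le_trans (le_of_eq ?_) hY1
        rw [hE]; ring_nf)
    rw [← pow_mul] at hq2 hq3
    refine ⟨q, hq1, hq2.trans (pow_le_pow_right₀ hK1 (by nlinarith)), hq3.mono ?_⟩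
    rw [mul_div_assoc', div_div, ← pow_add, ← pow_succ]
    gcongr ?_ / _
    exact pow_le_pow_right₀ hK1 (by nlinarith)

/-- If a polynomial phase is close to an integer on a dense set of integers, then its leading
coefficient is close to a rational with small denominator. -/
theorem polyPhase_recurrence (k : ℕ) : ∃ C : ℕ, ∀ K : ℝ, 2 ≤ K → ∀ (β : ℝ) (f : ℝ → ℝ),
    PolyPhase k β f → ∀ (H : ℕ) (S : Finset ℕ), K ^ C ≤ (H : ℝ) → S ⊆ Icc 1 H →
    (H : ℝ) / K ≤ S.card → ∀ ε : ℝ, (∀ n ∈ S, NearInt (f n) ε) → ε * K ^ C ≤ 1 →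
    ∃ q : ℕ, 1 ≤ q ∧ (q : ℝ) ≤ K ^ C ∧ NearInt (q * β) (K ^ C * ε / H ^ k) := by
  induction k with
  | zero =>
    refine ⟨0, fun K hK β f hf H S hH hS hcard ε hε _ => ⟨1, le_rfl, by simp, ?_⟩⟩
    have hH0 : (0 : ℝ) < H := lt_of_lt_of_le (by positivity) hH
    have hne : S.Nonempty := by
      rw [← card_pos]
      have : (0 : ℝ) < S.card := lt_of_lt_of_le (div_pos hH0 (by linarith)) hcard
      exact_mod_cast this
    obtain ⟨n, hn⟩ := hne
    have := hε n hn
    rw [hf n] at this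
    simpa using this
  | succ k ih =>
    obtain ⟨C, hC⟩ := ih
    set E := 5 * C + 1 + 21 * (5 * C + 5) with hE
    refine ⟨E, fun K hK β f hf H S hH hS hcard ε hε hεs => ?_⟩
    have hK0 : (0 : ℝ) < K := by linarith
    have hK1 : (1 : ℝ) ≤ K := by linarith
    have hH1' : (1 : ℝ) ≤ H := (one_le_pow₀ hK1).trans hH
    have hH0 : (0 : ℝ) < H := by linarith
    have hH1 : 1 ≤ H := by exact_mod_cast hH1'
    have hHK : 8 * K ^ 2 ≤ H := (eight_sq_le hK).trans
      ((pow_le_pow_right₀ hK1 (by omega)).trans hH)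
    have hε0 : 0 ≤ ε := by
      have hne : S.Nonempty := by
        rw [← card_pos]
        have : (0 : ℝ) < S.card := lt_of_lt_of_le (by positivity) hcard
        exact_mod_cast this
      obtain ⟨n, hn⟩ := hne
      exact (hε n hn).nonneg
    have hvdc := vanDerCorput S H (by
      intro m hm n hn
      have := mem_Icc.1 (hS hm)
      have := mem_Icc.1 (hS hn)
      omega) (fun _ => 1)
    simp only [sum_const, nsmul_eq_mul, mul_one, map_one, norm_one, one_pow,
      Complex.norm_natCast] at hvdc
    set a : ℕ → ℝ := fun h => ((S.filter (fun n => n + h ∈ S)).card : ℝ) with ha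
    have hcardS : (S.card : ℝ) ≤ H := by
      have := card_le_card hS
      rw [Nat.card_Icc] at this
      exact_mod_cast this
    have ha_le : ∀ h ∈ Icc 1 H, a h ≤ H := by
      intro h _
      exact le_trans (by simp only [ha]; exact_mod_cast card_filter_le _ _) hcardS
    have hsum : (H : ℝ) * H / (4 * K ^ 2) ≤ ∑ h ∈ Icc 1 H, a h := by
      have h1 : (2 : ℝ) ≤ S.card := by
        refine le_trans ?_ hcard
        rw [le_div_iff₀ hK0]
        nlinarith
      have h2 : ((H : ℝ) / K) ^ 2 ≤ (S.card : ℝ) ^ 2 := by gcongr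
      have h5 : ((H : ℝ) / K) ^ 2 = 4 * (H * H / (4 * K ^ 2)) := by field_simp
      simp only [ha]
      nlinarith
    have hpop := exists_popular (s := Icc 1 H) (by positivity) hH0 (by simp) ha_le hsum
    set T := (Icc 1 H).filter (fun i => (H : ℝ) / (2 * (4 * K ^ 2)) ≤ a i) with hTdef
    have hH8 : ∀ e : ℕ, 5 ≤ e → (H : ℝ) / K ^ e ≤ H / (2 * (4 * K ^ 2)) := by
      intro e he
      have : K ^ 5 ≤ K ^ e := pow_le_pow_right₀ hK1 he
      have := eight_sq_le hK
      gcongr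
      linarith
    have hHk : (1 : ℝ) ≤ (H : ℝ) ^ k := one_le_pow₀ hH1'
    have hrec : ∀ h ∈ T, ∃ q : ℕ, 1 ≤ q ∧ (q : ℝ) ≤ K ^ (5 * C + 5) ∧
        NearInt (q * (β * h)) (K ^ (5 * C + 1) * ε / H ^ k) := by
      intro h hh
      rw [hTdef, mem_filter] at hh
      obtain ⟨q, hq1, hq2, hq3⟩ := hC (K ^ 5) (hK.trans (le_self_pow₀ hK1 (by norm_num)))
        (β * h) _ (hf h) H (S.filter (fun n => n + h ∈ S))
        (by rw [← pow_mul]; exact (pow_le_pow_right₀ hK1 (by omega)).trans hH)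
        ((filter_subset _ _).trans hS) ((hH8 5 le_rfl).trans hh.2) (ε + ε)
        (by
          intro n hn
          rw [mem_filter] at hn
          have := (hε _ hn.2).sub (hε _ hn.1)
          push_cast at this
          exact this)
        (by
          rw [← pow_mul]
          calc (ε + ε) * K ^ (5 * C) = ε * (2 * K ^ (5 * C)) := by ring
            _ ≤ ε * (K * K ^ (5 * C)) := by gcongr
            _ = ε * K ^ (5 * C + 1) := by ring
            _ ≤ ε * K ^ E := mul_le_mul_of_nonneg_left (pow_le_pow_right₀ hK1 (by omega)) hε0
            _ ≤ 1 := hεs)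
      rw [← pow_mul] at hq2 hq3
      refine ⟨q, hq1, hq2.trans (pow_le_pow_right₀ hK1 (by omega)), hq3.mono ?_⟩
      gcongr ?_ / _
      calc K ^ (5 * C) * (ε + ε) = 2 * (K ^ (5 * C) * ε) := by ring
        _ ≤ K * (K ^ (5 * C) * ε) := by gcongr
        _ = _ := by ring
    obtain ⟨q, hq1, hq2, hq3⟩ := linear_recurrence_var (K := K ^ (5 * C + 5))
      (hK.trans (le_self_pow₀ hK1 (by omega))) (S := T) (filter_subset _ _) hH1
      ((hH8 _ (by omega)).trans hpop) hrec (by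
        rw [div_mul_eq_mul_div, div_le_one (by positivity), ← pow_mul]
        refine le_trans (le_trans (le_of_eq ?_) hεs) hHk
        rw [hE]; ring_nf)
    rw [← pow_mul] at hq2 hq3
    refine ⟨q, hq1, hq2.trans (pow_le_pow_right₀ hK1 (by omega)), hq3.mono (le_of_eq ?_)⟩
    rw [mul_div_assoc', div_div, ← mul_assoc, ← pow_add, ← pow_succ, hE]
    ring_nf

/-- The phase `e(f(x))` transported to the progression of the integers `n = Wx + b`. -/
noncomputable def apPhase (f : ℝ → ℝ) (b W n : ℕ) : ℂ :=
  if n ≡ b [MOD W] then eC (f (((n : ℝ) - b) / W)) else 0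

lemma norm_apPhase_le (f : ℝ → ℝ) (b W n : ℕ) : ‖apPhase f b W n‖ ≤ 1 := by
  unfold apPhase
  split_ifs
  · rw [norm_eC]
  · simp

lemma exists_sum_residue_eq {W r : ℕ} (hr : r < W) (m₁ m₂ : ℕ) :
    ∃ u v : ℕ, v ≤ u + (m₂ - m₁) ∧ ∀ g : ℕ → ℂ,
      ∑ m ∈ (Ico m₁ m₂).filter (fun m => m % W = r), g m = ∑ y ∈ Ico u v, g (W * y + r) := by
  have hW : 0 < W := by omega
  have key : ∀ m y : ℕ, (m - r + (W - 1)) / W ≤ y ↔ m ≤ W * y + r := by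
    intro m y
    rw [Nat.div_le_iff_le_mul_add_pred hW]
    omega
  refine ⟨(m₁ - r + (W - 1)) / W, (m₂ - r + (W - 1)) / W, ?_, fun g => ?_⟩
  · rw [key]
    have h1 := (key m₁ _).1 le_rfl
    have h2 : m₂ - m₁ ≤ W * (m₂ - m₁) := Nat.le_mul_of_pos_left _ hW
    rw [mul_add]
    omega
  · refine sum_nbij' (fun m => m / W) (fun y => W * y + r) ?_ ?_ ?_ ?_ ?_
    · intro m hm
      rw [mem_filter, mem_Ico] at hm
      have hmd := Nat.div_add_mod m W
      rw [hm.2] at hmd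
      rw [mem_Ico, key, ← not_le, key, hmd]
      omega
    · intro y hy
      rw [mem_Ico, key, ← not_le, key] at hy
      rw [mem_filter, mem_Ico]
      refine ⟨by omega, ?_⟩
      rw [Nat.mul_add_mod, Nat.mod_eq_of_lt hr]
    · intro m hm
      rw [mem_filter] at hm
      rw [← hm.2]
      exact Nat.div_add_mod m W
    · intro y _
      rw [Nat.mul_add_div hW, Nat.div_eq_of_lt hr, add_zero]
    · intro m hm
      rw [mem_filter] at hm
      rw [← hm.2, Nat.div_add_mod m W]

theorem weyl_inverse_residue (k : ℕ) : ∃ C : ℕ, ∀ K : ℝ, 2 ≤ K → ∀ (β : ℝ) (f : ℝ → ℝ),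
    PolyPhase (k + 1) β f → ∀ W : ℕ, 1 ≤ W → ∀ (p : ℕ → Prop) [DecidablePred p],
    (∀ m₀ m, p m₀ → (p m ↔ m ≡ m₀ [MOD W])) → ∀ Y m₁ m₂ : ℕ, 1 ≤ Y → m₂ ≤ m₁ + Y →
    (Y : ℝ) / K ≤ ‖∑ m ∈ Ico m₁ m₂, if p m then eC (f m) else 0‖ →
    ∃ q : ℕ, 1 ≤ q ∧ (q : ℝ) ≤ K ^ C ∧
      NearInt (q * (β * (W : ℝ) ^ (k + 1))) (K ^ C / Y ^ (k + 1)) := by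
  obtain ⟨C, hC⟩ := weyl_inverse k
  refine ⟨C, fun K hK β f hf W hW p _ hp Y m₁ m₂ hY hm hS => ?_⟩
  have hY0 : (0 : ℝ) < Y := by exact_mod_cast hY
  obtain ⟨m₀, hm₀⟩ : ∃ m₀, p m₀ := by
    by_contra h
    push Not at h
    simp only [h, if_false, sum_const_zero, norm_zero] at hS
    have : 0 < (Y : ℝ) / K := by positivity
    linarith
  obtain ⟨u, v, huv, hsum⟩ := exists_sum_residue_eq (Nat.mod_lt m₀ hW) m₁ m₂
  refine hC K hK _ _ (hf.comp_affine W ((m₀ % W : ℕ) : ℝ)) Y u v hY (by omega) ?_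
  refine hS.trans (le_of_eq ?_)
  rw [← sum_filter]
  have : (Ico m₁ m₂).filter p = (Ico m₁ m₂).filter (fun m => m % W = m₀ % W) := by
    ext m; simp only [mem_filter, hp m₀ m hm₀, Nat.ModEq]
  rw [this, hsum]
  push_cast
  rfl

lemma modEq_mul_iff {b W n m₀ : ℕ} (hbW : Nat.gcd b W = 1) (h₀ : n * m₀ ≡ b [MOD W]) (m : ℕ) :
    n * m ≡ b [MOD W] ↔ m ≡ m₀ [MOD W] := by
  have hn : Nat.gcd W n = 1 := by
    have h1 : Nat.gcd (n * m₀) W = 1 := by rw [h₀.gcd_eq, hbW]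
    exact (Nat.Coprime.coprime_mul_right h1).symm
  constructor
  · intro h
    exact Nat.ModEq.cancel_left_of_coprime hn (h.trans h₀.symm)
  · intro h
    exact (h.mul_left n).trans h₀

lemma PolyPhase.dilate {k : ℕ} {β : ℝ} {f : ℝ → ℝ} (hf : PolyPhase k β f) (b W n : ℕ) :
    PolyPhase k (β * (n / W : ℝ) ^ k) (fun x => f ((n * x - b) / W)) := by
  convert hf.comp_affine ((n : ℝ) / W) (-(b / W : ℝ)) using 1
  ext x
  congr 1
  ring

theorem typeI_single (k : ℕ) : ∃ C : ℕ, ∀ K : ℝ, 2 ≤ K → ∀ (β : ℝ) (f : ℝ → ℝ),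
    PolyPhase (k + 1) β f → ∀ b W : ℕ, 1 ≤ W → Nat.gcd b W = 1 →
    ∀ n Y m₁ m₂ : ℕ, 1 ≤ Y → m₂ ≤ m₁ + Y →
    (Y : ℝ) / K ≤ ‖∑ m ∈ Ico m₁ m₂, apPhase f b W (n * m)‖ →
    ∃ q : ℕ, 1 ≤ q ∧ (q : ℝ) ≤ K ^ C ∧
      NearInt (q * (β * (n : ℝ) ^ (k + 1))) (K ^ C / Y ^ (k + 1)) := by
  obtain ⟨C, hC⟩ := weyl_inverse_residue k
  refine ⟨C, fun K hK β f hf b W hW hbW n Y m₁ m₂ hY hm hS => ?_⟩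
  have hW0 : (W : ℝ) ≠ 0 := by positivity
  have := hC K hK _ _ (hf.dilate b W n) W hW (fun m => n * m ≡ b [MOD W])
    (fun m₀ m h => modEq_mul_iff hbW h m) Y m₁ m₂ hY hm (by
      simpa [apPhase] using hS)
  rwa [div_pow, mul_assoc, div_mul_cancel₀ _ (by positivity)] at this

theorem typeII_single (k : ℕ) : ∃ C : ℕ, ∀ K : ℝ, 2 ≤ K → ∀ (β : ℝ) (f : ℝ → ℝ),
    PolyPhase (k + 1) β f → ∀ b W : ℕ, 1 ≤ W → Nat.gcd b W = 1 →
    ∀ n n' Y m₁ m₂ : ℕ, 1 ≤ Y → m₂ ≤ m₁ + Y →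
    (Y : ℝ) / K ≤ ‖∑ m ∈ Ico m₁ m₂,
      apPhase f b W (n * m) * (starRingEnd ℂ) (apPhase f b W (n' * m))‖ →
    ∃ q : ℕ, 1 ≤ q ∧ (q : ℝ) ≤ K ^ C ∧
      NearInt (q * (β * ((n : ℝ) ^ (k + 1) - (n' : ℝ) ^ (k + 1)))) (K ^ C / Y ^ (k + 1)) := by
  obtain ⟨C, hC⟩ := weyl_inverse_residue k
  refine ⟨C, fun K hK β f hf b W hW hbW n n' Y m₁ m₂ hY hm hS => ?_⟩
  have hW0 : (W : ℝ) ≠ 0 := by positivity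
  have := hC K hK _ _ ((hf.dilate b W n).sub (hf.dilate b W n')) W hW
    (fun m => n * m ≡ b [MOD W] ∧ n' * m ≡ b [MOD W])
    (fun m₀ m h => by rw [modEq_mul_iff hbW h.1, modEq_mul_iff hbW h.2, and_self])
    Y m₁ m₂ hY hm (by
      refine hS.trans (le_of_eq ?_)
      congr 1
      refine sum_congr rfl fun m _ => ?_
      unfold apPhase
      split_ifs with h1 h2 h3 h3 h2 h3 h3
      · rw [eC_mul_conj]; push_cast; rfl
      · tauto
      · tauto
      · simp
      · tauto
      · simp
      · tauto
      · simp)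
  have e : (β * ((n : ℝ) / W) ^ (k + 1) - β * ((n' : ℝ) / W) ^ (k + 1)) * (W : ℝ) ^ (k + 1)
      = β * ((n : ℝ) ^ (k + 1) - (n' : ℝ) ^ (k + 1)) := by
    rw [div_pow, div_pow]; field_simp
  rwa [e] at this

lemma natCast_le_pow_self {K : ℝ} (hK : 2 ≤ K) (n : ℕ) : (n : ℝ) ≤ K ^ n := by
  calc (n : ℝ) ≤ ((2 ^ n : ℕ) : ℝ) := by exact_mod_cast Nat.lt_two_pow_self.le
    _ = 2 ^ n := by push_cast; rfl
    _ ≤ K ^ n := by gcongr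

theorem typeI_inverse (k : ℕ) : ∃ C : ℕ, ∀ K : ℝ, 2 ≤ K → ∀ (β : ℝ) (f : ℝ → ℝ),
    PolyPhase (k + 1) β f → ∀ b W : ℕ, 1 ≤ W → Nat.gcd b W = 1 →
    ∀ (H Y : ℕ) (S : Finset ℕ), 1 ≤ H → K ^ C ≤ (Y : ℝ) → S ⊆ Icc 1 H → (H : ℝ) / K ≤ S.card →
    (∀ d ∈ S, ∃ m₁ m₂ : ℕ, m₂ ≤ m₁ + Y ∧
      (Y : ℝ) / K ≤ ‖∑ m ∈ Ico m₁ m₂, apPhase f b W (d * m)‖) →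
    ∃ Q : ℕ, 1 ≤ Q ∧ (Q : ℝ) ≤ K ^ C ∧ NearInt (Q * β) (K ^ C / ((H : ℝ) * Y) ^ (k + 1)) := by
  obtain ⟨C₁, hC₁⟩ := typeI_single k
  obtain ⟨C₂, hC₂⟩ := polyPhase_recurrence (k + 1)
  set E := (2 * C₁ + 2) * C₂ with hE
  refine ⟨C₁ + E * (k + 1) + E + (k + 1).factorial,
    fun K hK β f hf b W hW hbW H Y S hH hY hS hcard hlarge => ?_⟩
  set C := C₁ + E * (k + 1) + E + (k + 1).factorial with hC
  have hK1 : (1 : ℝ) ≤ K := by linarith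
  have hK0 : (0 : ℝ) < K := by linarith
  have hY1' : (1 : ℝ) ≤ Y := (one_le_pow₀ hK1).trans hY
  have hY0 : (0 : ℝ) < Y := by linarith
  have hY1 : 1 ≤ Y := by exact_mod_cast hY1'
  have hH0 : (0 : ℝ) < H := by exact_mod_cast hH
  have hq : ∀ d ∈ S, ∃ q : ℕ, 1 ≤ q ∧ (q : ℝ) ≤ K ^ C₁ ∧
      NearInt (q * (β * (d : ℝ) ^ (k + 1))) (K ^ C₁ / Y ^ (k + 1)) := by
    intro d hd
    obtain ⟨m₁, m₂, hm, hsum⟩ := hlarge d hd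
    exact hC₁ K hK β f hf b W hW hbW d Y m₁ m₂ hY1 hm hsum
  choose! q hq1 hq2 hq3 using hq
  rcases lt_or_ge (H : ℝ) (K ^ E) with hsm | hlg
  · have hne : S.Nonempty := by
      rw [← card_pos]
      have : (0 : ℝ) < S.card := lt_of_lt_of_le (by positivity) hcard
      exact_mod_cast this
    obtain ⟨d, hd⟩ := hne
    have hd' := mem_Icc.1 (hS hd)
    have hHE : (H : ℝ) ^ (k + 1) ≤ K ^ (E * (k + 1)) := by
      rw [pow_mul]; gcongr
    have hdH : (d : ℝ) ^ (k + 1) ≤ K ^ (E * (k + 1)) := by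
      have hdH : (d : ℝ) ≤ H := by exact_mod_cast hd'.2
      exact (pow_le_pow_left₀ (Nat.cast_nonneg d) hdH (k + 1)).trans hHE
    have hCle : K ^ (C₁ + E * (k + 1)) ≤ K ^ C := pow_le_pow_right₀ hK1 (by omega)
    refine ⟨q d * d ^ (k + 1), Nat.mul_pos (hq1 d hd) (Nat.pow_pos hd'.1), ?_, ?_⟩
    · push_cast
      refine le_trans ?_ hCle
      rw [pow_add K]
      exact mul_le_mul (hq2 d hd) hdH (by positivity) (by positivity)
    · push_cast
      rw [mul_assoc, mul_comm _ β]
      refine (hq3 d hd).mono ?_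
      rw [mul_pow, div_le_div_iff₀ (by positivity) (by positivity)]
      calc K ^ C₁ * ((H : ℝ) ^ (k + 1) * Y ^ (k + 1)) ≤
          K ^ C₁ * (K ^ (E * (k + 1)) * Y ^ (k + 1)) := by gcongr
        _ = K ^ (C₁ + E * (k + 1)) * Y ^ (k + 1) := by ring
        _ ≤ K ^ C * Y ^ (k + 1) := by gcongr
  · have hKp : K ≤ K ^ (C₁ + 1) := le_self_pow₀ hK1 (by omega)
    obtain ⟨q', hq'1, hq'2, hq'3⟩ := exists_common_value (K := K ^ (C₁ + 1)) (hK.trans hKp)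
      (S := S) (B := H) (le_trans (by gcongr) hcard) (f := q)
      (fun d hd => ⟨hq1 d hd, (hq2 d hd).trans (pow_le_pow_right₀ hK1 (by omega))⟩)
    have hp2 : (K ^ (C₁ + 1)) ^ 2 = K ^ (2 * C₁ + 2) := by rw [← pow_mul]; ring_nf
    rw [hp2] at hq'3
    have hne : (S.filter (fun d => q d = q')).Nonempty := by
      rw [← card_pos]
      have : (0 : ℝ) < (S.filter (fun d => q d = q')).card := lt_of_lt_of_le (by positivity) hq'3
      exact_mod_cast this
    have hq'K : (q' : ℝ) ≤ K ^ C₁ := by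
      obtain ⟨d, hd⟩ := hne
      rw [mem_filter] at hd
      rw [← hd.2]; exact hq2 d hd.1
    obtain ⟨r, hr1, hr2, hr3⟩ := hC₂ (K ^ (2 * C₁ + 2))
      (hK.trans (le_self_pow₀ hK1 (by omega))) _ _ ((polyPhase_pow (k + 1)).const_mul (q' * β))
      H (S.filter (fun d => q d = q')) (by rwa [← pow_mul]) ((filter_subset _ _).trans hS) hq'3
      (K ^ C₁ / Y ^ (k + 1)) (by
        intro d hd
        rw [mem_filter] at hd
        have := hq3 d hd.1
        rwa [hd.2, ← mul_assoc] at this) (by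
        rw [← pow_mul, div_mul_eq_mul_div, div_le_one (by positivity), ← pow_add]
        calc K ^ (C₁ + E) ≤ K ^ C := pow_le_pow_right₀ hK1 (by omega)
          _ ≤ Y := hY
          _ ≤ (Y : ℝ) ^ (k + 1) := le_self_pow₀ hY1' (by omega))
    rw [← pow_mul] at hr2 hr3
    have hfac := natCast_le_pow_self hK (k + 1).factorial
    refine ⟨r * (q' * (k + 1).factorial),
      Nat.mul_pos hr1 (Nat.mul_pos hq'1 (Nat.factorial_pos _)), ?_, ?_⟩
    · push_cast
      calc (r : ℝ) * (q' * (k + 1).factorial) ≤ K ^ E * (K ^ C₁ * K ^ (k + 1).factorial) := by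
            gcongr
        _ = K ^ (E + (C₁ + (k + 1).factorial)) := by rw [pow_add, pow_add]
        _ ≤ K ^ C := pow_le_pow_right₀ hK1 (by omega)
    · push_cast
      have e : (r : ℝ) * (q' * (k + 1).factorial) * β = r * (q' * β * (k + 1).factorial) := by ring
      rw [e]
      refine hr3.mono ?_
      rw [mul_div_assoc', ← pow_add, div_div, ← mul_pow, mul_comm (Y : ℝ)]
      gcongr ?_ / _
      exact pow_le_pow_right₀ hK1 (by omega)

theorem typeII_inverse (k : ℕ) : ∃ C : ℕ, ∀ K : ℝ, 2 ≤ K → ∀ (β : ℝ) (f : ℝ → ℝ),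
    PolyPhase (k + 1) β f → ∀ b W : ℕ, 1 ≤ W → Nat.gcd b W = 1 →
    ∀ (H Y : ℕ) (S : Finset (ℕ × ℕ)), K ^ C ≤ (H : ℝ) → K ^ C ≤ (Y : ℝ) →
    S ⊆ Icc 1 H ×ˢ Icc 1 H → (H : ℝ) ^ 2 / K ≤ S.card →
    (∀ p ∈ S, ∃ m₁ m₂ : ℕ, m₂ ≤ m₁ + Y ∧
      (Y : ℝ) / K ≤ ‖∑ m ∈ Ico m₁ m₂,
        apPhase f b W (p.1 * m) * (starRingEnd ℂ) (apPhase f b W (p.2 * m))‖) →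
    ∃ Q : ℕ, 1 ≤ Q ∧ (Q : ℝ) ≤ K ^ C ∧ NearInt (Q * β) (K ^ C / ((H : ℝ) * Y) ^ (k + 1)) := by
  obtain ⟨C₁, hC₁⟩ := typeII_single k
  obtain ⟨C₂, hC₂⟩ := polyPhase_recurrence (k + 1)
  set E := (2 * C₁ + 2) * C₂ with hE
  refine ⟨C₁ + E + (k + 1).factorial,
    fun K hK β f hf b W hW hbW H Y S hH hY hS hcard hlarge => ?_⟩
  set C := C₁ + E + (k + 1).factorial with hC
  have hK1 : (1 : ℝ) ≤ K := by linarith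
  have hK0 : (0 : ℝ) < K := by linarith
  have hY1' : (1 : ℝ) ≤ Y := (one_le_pow₀ hK1).trans hY
  have hY0 : (0 : ℝ) < Y := by linarith
  have hY1 : 1 ≤ Y := by exact_mod_cast hY1'
  have hH1 : (1 : ℝ) ≤ H := (one_le_pow₀ hK1).trans hH
  have hH0 : (0 : ℝ) < H := by linarith
  have hq : ∀ p ∈ S, ∃ q : ℕ, 1 ≤ q ∧ (q : ℝ) ≤ K ^ C₁ ∧
      NearInt (q * (β * ((p.1 : ℝ) ^ (k + 1) - (p.2 : ℝ) ^ (k + 1)))) (K ^ C₁ / Y ^ (k + 1)) := by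
    intro p hp
    obtain ⟨m₁, m₂, hm, hsum⟩ := hlarge p hp
    exact hC₁ K hK β f hf b W hW hbW p.1 p.2 Y m₁ m₂ hY1 hm hsum
  choose! q hq1 hq2 hq3 using hq
  have hKp : K ≤ K ^ (C₁ + 1) := le_self_pow₀ hK1 (by omega)
  obtain ⟨q', hq'1, hq'2, hq'3⟩ := exists_common_value (K := K ^ (C₁ + 1)) (hK.trans hKp)
    (S := S) (B := (H : ℝ) ^ 2) (le_trans (by gcongr) hcard) (f := q)
    (fun d hd => ⟨hq1 d hd, (hq2 d hd).trans (pow_le_pow_right₀ hK1 (by omega))⟩)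
  have hp2 : (K ^ (C₁ + 1)) ^ 2 = K ^ (2 * C₁ + 2) := by rw [← pow_mul]; ring_nf
  rw [hp2] at hq'3
  have hne : (S.filter (fun d => q d = q')).Nonempty := by
    rw [← card_pos]
    have : (0 : ℝ) < (S.filter (fun d => q d = q')).card := lt_of_lt_of_le (by positivity) hq'3
    exact_mod_cast this
  have hq'K : (q' : ℝ) ≤ K ^ C₁ := by
    obtain ⟨d, hd⟩ := hne
    rw [mem_filter] at hd
    rw [← hd.2]; exact hq2 d hd.1
  obtain ⟨n', hn', hn'c⟩ := exists_le_card_fiber_of_nsmul_le_card_of_maps_to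
    (s := S.filter (fun d => q d = q')) (t := Icc 1 H) (f := Prod.snd)
    (b := (H : ℝ) / K ^ (2 * C₁ + 2))
    (fun p hp => (mem_product.1 (hS (mem_filter.1 hp).1)).2)
    ⟨1, mem_Icc.2 ⟨le_rfl, by exact_mod_cast hH1⟩⟩ (by
      rw [nsmul_eq_mul, Nat.card_Icc, Nat.add_sub_cancel, mul_div_assoc', ← sq]
      exact hq'3)
  set T := ((S.filter (fun d => q d = q')).filter (fun p => p.2 = n')).image Prod.fst with hT
  have hTcard : (H : ℝ) / K ^ (2 * C₁ + 2) ≤ T.card := by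
    rw [hT, card_image_of_injOn]
    · exact hn'c
    · intro p hp p' hp' h
      have h1 := (mem_filter.1 (mem_coe.1 hp)).2
      have h2 := (mem_filter.1 (mem_coe.1 hp')).2
      exact Prod.ext h (h1.trans h2.symm)
  have hTn : ∀ n ∈ T, (n, n') ∈ S ∧ q (n, n') = q' := by
    intro n hn
    rw [hT, mem_image] at hn
    obtain ⟨⟨n₁, n₂⟩, hp, rfl⟩ := hn
    simp only [mem_filter] at hp
    obtain ⟨⟨h1, h2⟩, h3⟩ := hp
    simp only at h3 ⊢
    subst h3
    exact ⟨h1, h2⟩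
  obtain ⟨r, hr1, hr2, hr3⟩ := hC₂ (K ^ (2 * C₁ + 2))
    (hK.trans (le_self_pow₀ hK1 (by omega))) _ _
    (((polyPhase_pow (k + 1)).sub (polyPhase_const k ((n' : ℝ) ^ (k + 1)))).const_mul (q' * β))
    H T (by
      rw [← pow_mul]
      exact (pow_le_pow_right₀ hK1 (by omega)).trans hH)
    (fun n hn => (mem_product.1 (hS (hTn n hn).1)).1) hTcard
    (K ^ C₁ / Y ^ (k + 1)) (by
      intro n hn
      have := hq3 _ (hTn n hn).1
      rwa [(hTn n hn).2, ← mul_assoc] at this) (by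
      rw [← pow_mul, div_mul_eq_mul_div, div_le_one (by positivity), ← pow_add]
      calc K ^ (C₁ + E) ≤ K ^ C := pow_le_pow_right₀ hK1 (by omega)
        _ ≤ Y := hY
        _ ≤ (Y : ℝ) ^ (k + 1) := le_self_pow₀ hY1' (by omega))
  rw [← pow_mul] at hr2 hr3
  have hfac := natCast_le_pow_self hK (k + 1).factorial
  refine ⟨r * (q' * (k + 1).factorial),
    Nat.mul_pos hr1 (Nat.mul_pos hq'1 (Nat.factorial_pos _)), ?_, ?_⟩
  · push_cast
    calc (r : ℝ) * (q' * (k + 1).factorial) ≤ K ^ E * (K ^ C₁ * K ^ (k + 1).factorial) := by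
          gcongr
      _ = K ^ (E + (C₁ + (k + 1).factorial)) := by rw [pow_add, pow_add]
      _ ≤ K ^ C := pow_le_pow_right₀ hK1 (by omega)
  · push_cast
    have e : (r : ℝ) * (q' * (k + 1).factorial) * β
        = r * (q' * β * ((k + 1).factorial - 0)) := by ring
    rw [e]
    refine hr3.mono ?_
    rw [mul_div_assoc', ← pow_add, div_div, ← mul_pow, mul_comm (Y : ℝ)]
    gcongr ?_ / _
    exact pow_le_pow_right₀ hK1 (by omega)

lemma sum_divisorsAntidiagonal_eq {M : Type*} [AddCommMonoid M] (X : ℕ) (g : ℕ → ℕ → M) :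
    ∑ n ∈ Icc 1 X, ∑ p ∈ n.divisorsAntidiagonal, g p.1 p.2 =
      ∑ d ∈ Icc 1 X, ∑ l ∈ Icc 1 (X / d), g d l := by
  rw [sum_sigma', sum_sigma']
  refine sum_nbij' (fun x => ⟨x.2.1, x.2.2⟩) (fun y => ⟨y.1 * y.2, (y.1, y.2)⟩) ?_ ?_ ?_ ?_ ?_
  · rintro ⟨n, d, l⟩ h
    simp only [mem_sigma, mem_Icc, Nat.mem_divisorsAntidiagonal] at h ⊢
    obtain ⟨⟨h1, h2⟩, rfl, h3⟩ := h
    have hd : 0 < d := Nat.pos_of_ne_zero fun h => by simp [h] at h3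
    have hl : 0 < l := Nat.pos_of_ne_zero fun h => by simp [h] at h3
    refine ⟨⟨hd, le_trans (Nat.le_mul_of_pos_right d hl) h2⟩, hl, ?_⟩
    rw [Nat.le_div_iff_mul_le hd, mul_comm]
    exact h2
  · rintro ⟨d, l⟩ h
    simp only [mem_sigma, mem_Icc, Nat.mem_divisorsAntidiagonal] at h ⊢
    obtain ⟨⟨h1, h2⟩, h3, h4⟩ := h
    rw [Nat.le_div_iff_mul_le h1, mul_comm] at h4
    have := Nat.mul_pos h1 h3
    exact ⟨⟨this, h4⟩, trivial, this.ne'⟩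
  · rintro ⟨n, d, l⟩ h
    simp only [mem_sigma, mem_Icc, Nat.mem_divisorsAntidiagonal] at h
    obtain ⟨_, rfl, _⟩ := h
    rfl
  · rintro ⟨d, l⟩ _
    rfl
  · rintro ⟨n, d, l⟩ _
    rfl

lemma sum_inv_le (n : ℕ) : ∑ d ∈ Icc 1 n, ((d : ℝ))⁻¹ ≤ 1 + Real.log n := by
  have := harmonic_le_one_add_log n
  rw [harmonic_eq_sum_Icc] at this
  push_cast at this
  exact this

lemma card_divisors_mul_le (m n : ℕ) :
    (m * n).divisors.card ≤ m.divisors.card * n.divisors.card := by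
  rw [Nat.divisors_mul]
  exact card_mul_le

lemma card_divisors_eq_sum (n : ℕ) :
    ((n.divisors.card : ℕ) : ℝ) = ∑ _p ∈ n.divisorsAntidiagonal, (1 : ℝ) := by
  rw [← Nat.map_div_right_divisors]
  simp

lemma sum_card_divisors_le (X : ℕ) :
    ∑ n ∈ Icc 1 X, ((n.divisors.card : ℕ) : ℝ) ≤ X * (1 + Real.log X) := by
  simp_rw [card_divisors_eq_sum]
  rw [sum_divisorsAntidiagonal_eq X (fun _ _ => (1 : ℝ))]
  calc _ ≤ ∑ d ∈ Icc 1 X, (X : ℝ) * (d : ℝ)⁻¹ := by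
        refine sum_le_sum fun d _ => ?_
        simpa [div_eq_mul_inv] using (Nat.cast_div_le (α := ℝ) (m := X) (n := d))
    _ ≤ _ := by
        rw [← mul_sum]
        gcongr
        exact sum_inv_le X

lemma sum_card_divisors_div_le (X : ℕ) :
    ∑ n ∈ Icc 1 X, ((n.divisors.card : ℕ) : ℝ) * (n : ℝ)⁻¹ ≤ (1 + Real.log X) ^ 2 := by
  have h : ∀ n ∈ Icc 1 X, ((n.divisors.card : ℕ) : ℝ) * (n : ℝ)⁻¹ =
      ∑ p ∈ n.divisorsAntidiagonal, (p.1 : ℝ)⁻¹ * (p.2 : ℝ)⁻¹ := by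
    intro n _
    rw [card_divisors_eq_sum, sum_mul]
    refine sum_congr rfl fun p hp => ?_
    rw [← (Nat.mem_divisorsAntidiagonal.1 hp).1]
    push_cast
    rw [mul_inv, one_mul]
  rw [sum_congr rfl h, sum_divisorsAntidiagonal_eq X (fun d l => (d : ℝ)⁻¹ * (l : ℝ)⁻¹), sq]
  have h0 : 0 ≤ 1 + Real.log X := by
    have := Real.log_natCast_nonneg X
    linarith
  calc _ ≤ ∑ d ∈ Icc 1 X, (d : ℝ)⁻¹ * (1 + Real.log X) := by
        refine sum_le_sum fun d hd => ?_
        rw [← mul_sum]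
        gcongr
        refine le_trans ?_ (sum_inv_le X)
        refine sum_le_sum_of_subset_of_nonneg ?_ fun _ _ _ => by positivity
        exact Icc_subset_Icc le_rfl (Nat.div_le_self _ _)
    _ ≤ _ := by
        rw [← sum_mul]
        gcongr
        exact sum_inv_le X

lemma sum_card_divisors_sq_le (X : ℕ) :
    ∑ n ∈ Icc 1 X, ((n.divisors.card : ℕ) : ℝ) ^ 2 ≤ X * (1 + Real.log X) ^ 3 := by
  have h : ∀ n ∈ Icc 1 X, ((n.divisors.card : ℕ) : ℝ) ^ 2 ≤
      ∑ p ∈ n.divisorsAntidiagonal,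
        ((p.1.divisors.card : ℕ) : ℝ) * ((p.2.divisors.card : ℕ) : ℝ) := by
    intro n _
    rw [sq]
    nth_rw 1 [card_divisors_eq_sum]
    rw [sum_mul]
    refine sum_le_sum fun p hp => ?_
    rw [← (Nat.mem_divisorsAntidiagonal.1 hp).1, one_mul]
    exact_mod_cast card_divisors_mul_le p.1 p.2
  refine (sum_le_sum h).trans ?_
  rw [sum_divisorsAntidiagonal_eq X
    (fun d l => ((d.divisors.card : ℕ) : ℝ) * ((l.divisors.card : ℕ) : ℝ))]
  have h0 : 0 ≤ 1 + Real.log X := by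
    have := Real.log_natCast_nonneg X
    linarith
  calc _ ≤ ∑ d ∈ Icc 1 X,
        ((d.divisors.card : ℕ) : ℝ) * (d : ℝ)⁻¹ * (X * (1 + Real.log X)) := by
        refine sum_le_sum fun d hd => ?_
        rw [← mul_sum, mul_assoc]
        have hd := mem_Icc.1 hd
        refine mul_le_mul_of_nonneg_left ?_ (by positivity)
        refine (sum_card_divisors_le (X / d)).trans ?_
        have h1 : ((X / d : ℕ) : ℝ) ≤ (d : ℝ)⁻¹ * X := by
          have := Nat.cast_div_le (α := ℝ) (m := X) (n := d)
          rwa [div_eq_inv_mul] at this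
        have h2 : Real.log ((X / d : ℕ) : ℝ) ≤ Real.log X := by
          refine Real.log_le_log ?_ (by exact_mod_cast Nat.div_le_self _ _)
          exact_mod_cast Nat.div_pos hd.2 hd.1
        rw [← mul_assoc]
        refine mul_le_mul h1 (by linarith) ?_ (by positivity)
        have := Real.log_natCast_nonneg (X / d)
        linarith
    _ ≤ (1 + Real.log X) ^ 2 * (X * (1 + Real.log X)) := by
        rw [← sum_mul]
        gcongr
        exact sum_card_divisors_div_le X
    _ = _ := by ring

lemma log_two_add_one_le {X : ℕ} (hX : 1 ≤ X) {K : ℝ} (hK : 1 + Real.log (2 * X) ≤ K) :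
    ((Nat.log 2 X + 1 : ℕ) : ℝ) ≤ 2 * K := by
  have h1 : (2 : ℝ) ^ (Nat.log 2 X + 1) ≤ 2 * X := by
    have := Nat.pow_log_le_self 2 (x := X) (by omega)
    rw [pow_succ, mul_comm]
    have h2 : ((2 ^ Nat.log 2 X : ℕ) : ℝ) ≤ X := by exact_mod_cast this
    push_cast at h2
    linarith
  have h2 := Real.log_le_log (by positivity) h1
  rw [Real.log_pow] at h2
  have h3 := Real.log_two_gt_d9
  have h4 : (0 : ℝ) ≤ ((Nat.log 2 X + 1 : ℕ) : ℝ) := Nat.cast_nonneg _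
  nlinarith

lemma exists_dyadic_block {X : ℕ} (hX : 1 ≤ X) {K T : ℝ} (hK : 1 + Real.log (2 * X) ≤ K)
    {V : ℕ} (hV : V ≤ X) (g : ℕ → ℝ) (hg : T / K ≤ ∑ d ∈ Icc 1 V, g d) (hT : 0 < T) :
    ∃ D, 1 ≤ D ∧ T / (2 * K ^ 2) ≤ ∑ d ∈ (Icc 1 V).filter (fun d => D ≤ d ∧ d < 2 * D), g d := by
  have hX1 : (1 : ℝ) ≤ X := by exact_mod_cast hX
  have hlog : 0 ≤ Real.log (2 * X) := Real.log_nonneg (by linarith)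
  have hK0 : 0 < K := by linarith
  by_contra! hcon
  have hmaps : ∀ d ∈ Icc 1 V, Nat.log 2 d ∈ range (Nat.log 2 X + 1) := by
    intro d hd
    rw [mem_range, Nat.lt_succ_iff]
    exact Nat.log_mono_right ((mem_Icc.1 hd).2.trans hV)
  rw [← sum_fiberwise_of_maps_to hmaps] at hg
  have hlt : ∀ i ∈ range (Nat.log 2 X + 1),
      ∑ d ∈ (Icc 1 V).filter (fun d => Nat.log 2 d = i), g d < T / (2 * K ^ 2) := by
    intro i _
    refine lt_of_le_of_lt (le_of_eq ?_) (hcon (2 ^ i) Nat.one_le_two_pow)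
    refine sum_congr (filter_congr fun d hd => ?_) fun _ _ => rfl
    rw [Nat.log_eq_iff (Or.inr ⟨by norm_num, by have := mem_Icc.1 hd; omega⟩), pow_succ,
      mul_comm _ 2]
  have h1 := sum_lt_sum_of_nonempty (by simp) hlt
  rw [sum_const, card_range, nsmul_eq_mul] at h1
  have h2 : ((Nat.log 2 X + 1 : ℕ) : ℝ) * (T / (2 * K ^ 2)) ≤ 2 * K * (T / (2 * K ^ 2)) := by
    gcongr
    exact log_two_add_one_le hX hK
  have h3 : 2 * K * (T / (2 * K ^ 2)) = T / K := by field_simp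
  linarith

lemma norm_sum_Ico_le {g : ℕ → ℂ} (hg : ∀ n, ‖g n‖ ≤ 1) {m₁ m₂ Y : ℕ} (h : m₂ ≤ m₁ + Y) :
    ‖∑ m ∈ Ico m₁ m₂, g m‖ ≤ Y := by
  refine (norm_sum_le _ _).trans ?_
  calc ∑ m ∈ Ico m₁ m₂, ‖g m‖ ≤ ∑ _m ∈ Ico m₁ m₂, (1 : ℝ) := sum_le_sum fun m _ => hg m
    _ = ((m₂ - m₁ : ℕ) : ℝ) := by simp
    _ ≤ Y := by exact_mod_cast (by omega)

theorem typeI_sum (k : ℕ) : ∃ C : ℕ, ∀ K : ℝ, 2 ≤ K → ∀ (β : ℝ) (f : ℝ → ℝ),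
    PolyPhase (k + 1) β f → ∀ b W : ℕ, 1 ≤ W → Nat.gcd b W = 1 →
    ∀ X V : ℕ, 1 ≤ V → 1 + Real.log (2 * X) ≤ K → K ^ C * V ≤ (X : ℝ) →
    ∀ j : ℕ → ℕ, (∀ d, 1 ≤ j d) →
    (X : ℝ) / K ≤ ∑ d ∈ Icc 1 V, ‖∑ l ∈ Ico (j d) (X / d + 1), apPhase f b W (d * l)‖ →
    ∃ Q : ℕ, 1 ≤ Q ∧ (Q : ℝ) ≤ K ^ C ∧ NearInt (Q * β) (K ^ C / (X : ℝ) ^ (k + 1)) := by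
  obtain ⟨C₁, hC₁⟩ := typeI_inverse k
  refine ⟨5 * C₁ + 1, fun K hK β f hf b W hW hbW X V hV hlog hX j hj hsum => ?_⟩
  have hK1 : (1 : ℝ) ≤ K := by linarith
  have hK0 : (0 : ℝ) < K := by linarith
  have hV1 : (1 : ℝ) ≤ V := by exact_mod_cast hV
  have hVX : (V : ℝ) ≤ X := by
    refine le_trans ?_ hX
    exact le_mul_of_one_le_left (by linarith) (one_le_pow₀ hK1)
  have hX1' : (1 : ℝ) ≤ X := hV1.trans hVX
  have hX1 : 1 ≤ X := by exact_mod_cast hX1'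
  have hX0 : (0 : ℝ) < X := by linarith
  obtain ⟨D, hD, hblock⟩ := exists_dyadic_block hX1 hlog (by exact_mod_cast hVX) _ hsum hX0
  set s := (Icc 1 V).filter (fun d => D ≤ d ∧ d < 2 * D) with hs
  have hD0 : (0 : ℝ) < D := by exact_mod_cast hD
  have hne : s.Nonempty := by
    by_contra! h
    rw [h, sum_empty] at hblock
    have : 0 < (X : ℝ) / (2 * K ^ 2) := by positivity
    linarith
  have hDV : (D : ℝ) ≤ V := by
    obtain ⟨d, hd⟩ := hne
    simp only [hs, mem_filter, mem_Icc] at hd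
    exact_mod_cast hd.2.1.trans hd.1.2
  have hY' : (K ^ (5 * C₁ + 1) - 1) ≤ ((X / D : ℕ) : ℝ) := by
    have h1 := Nat.lt_div_mul_add (a := X) (b := D) (by omega)
    have h2 : (X : ℝ) < ((X / D : ℕ) : ℝ) * D + D := by exact_mod_cast h1
    have h3 : K ^ (5 * C₁ + 1) * D ≤ K ^ (5 * C₁ + 1) * V := by gcongr
    by_contra! h
    nlinarith
  have hY : (K ^ 5) ^ C₁ ≤ ((X / D : ℕ) : ℝ) := by
    refine le_trans ?_ hY'
    rw [← pow_mul, pow_succ]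
    have := one_le_pow₀ hK1 (n := 5 * C₁)
    nlinarith
  set Y := X / D with hYdef
  have hY1' : (1 : ℝ) ≤ Y := (one_le_pow₀ (one_le_pow₀ hK1)).trans hY
  have hY1 : 1 ≤ Y := by exact_mod_cast hY1'
  have hDY : D * Y ≤ X := Nat.mul_div_le _ _
  have hDY2 : X ≤ 2 * D * Y := by
    have h1 := Nat.lt_div_mul_add (a := X) (b := D) (by omega)
    rw [← hYdef] at h1
    nlinarith
  have hlen : ∀ d ∈ s, X / d + 1 ≤ j d + Y := by
    intro d hd
    simp only [hs, mem_filter, mem_Icc] at hd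
    have h1 : X / d ≤ X / D := Nat.div_le_div_left hd.2.1 hD
    have := hj d
    omega
  have hcard : (s.card : ℝ) ≤ D := by
    have : s ⊆ Ico D (2 * D) := by
      intro d hd
      simp only [hs, mem_filter] at hd
      exact mem_Ico.2 hd.2
    have := card_le_card this
    rw [Nat.card_Ico] at this
    exact_mod_cast (by omega)
  have hpop := exists_popular (s := s) (K := 2 * K ^ 2) (n := D) (B := Y) (by positivity)
    (by linarith) hcard
    (fun d hd => norm_sum_Ico_le (fun l => norm_apPhase_le f b W (d * l)) (hlen d hd))
    (le_trans (by gcongr; exact_mod_cast hDY) hblock)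
  have hK8 : 2 * (2 * (2 * K ^ 2)) ≤ K ^ 5 := by linarith [eight_sq_le hK]
  have hK5 : 2 * (2 * K ^ 2) ≤ K ^ 5 := by nlinarith [sq_nonneg K]
  obtain ⟨Q, hQ1, hQ2, hQ3⟩ := hC₁ (K ^ 5) (hK.trans (le_self_pow₀ hK1 (by norm_num))) β f hf b W
    hW hbW (2 * D) Y (s.filter _) (by omega) hY (by
      intro d hd
      simp only [hs, mem_filter, mem_Icc] at hd ⊢
      omega) (le_trans (by
        push_cast
        rw [div_le_div_iff₀ (by positivity) (by positivity)]
        nlinarith) hpop)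
    (fun d hd => by
      rw [mem_filter] at hd
      refine ⟨j d, X / d + 1, hlen d hd.1, le_trans ?_ hd.2⟩
      gcongr)
  have hCC : (K ^ 5) ^ C₁ ≤ K ^ (5 * C₁ + 1) := by
    rw [← pow_mul]
    exact pow_le_pow_right₀ hK1 (by omega)
  refine ⟨Q, hQ1, hQ2.trans hCC, hQ3.mono ?_⟩
  have : (X : ℝ) ≤ ((2 * D : ℕ) : ℝ) * Y := by exact_mod_cast hDY2
  gcongr

theorem typeII_sum (k : ℕ) : ∃ C : ℕ, ∀ K : ℝ, 2 ≤ K → ∀ (β : ℝ) (f : ℝ → ℝ),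
    PolyPhase (k + 1) β f → ∀ b W : ℕ, 1 ≤ W → Nat.gcd b W = 1 →
    ∀ X U : ℕ, 1 ≤ X → 1 + Real.log (2 * X) ≤ K → K ^ C ≤ (U : ℝ) →
    ∀ u v : ℕ → ℂ, (∀ m ≤ U, u m = 0) → (∀ n ≤ U, v n = 0) →
    (∀ m, ‖u m‖ ≤ (m.divisors.card : ℕ)) → (∀ n ≤ X, ‖v n‖ ≤ K) →
    (X : ℝ) / K ≤
      ‖∑ m ∈ Icc 1 X, u m * ∑ n ∈ Icc 1 (X / m), v n * apPhase f b W (n * m)‖ →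
    ∃ Q : ℕ, 1 ≤ Q ∧ (Q : ℝ) ≤ K ^ C ∧ NearInt (Q * β) (K ^ C / (X : ℝ) ^ (k + 1)) := by
  obtain ⟨C₁, hC₁⟩ := typeII_inverse k
  refine ⟨13 * C₁ + 1 + (k + 1),
    fun K hK β f hf b W hW hbW X U hX1 hlog hU u v hu0 hv0 hu hv hsum => ?_⟩
  have hK1 : (1 : ℝ) ≤ K := by linarith
  have hK0 : (0 : ℝ) < K := by linarith
  have hX1' : (1 : ℝ) ≤ X := by exact_mod_cast hX1
  have hX0 : (0 : ℝ) < X := by linarith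
  set G : ℕ → ℂ := fun m => ∑ n ∈ Icc 1 (X / m), v n * apPhase f b W (n * m) with hG
  have hsum' : (X : ℝ) / K ≤ ∑ m ∈ Icc 1 X, ‖u m‖ * ‖G m‖ := by
    refine hsum.trans ((norm_sum_le _ _).trans (le_of_eq ?_))
    exact sum_congr rfl fun m _ => norm_mul _ _
  obtain ⟨M, hM, hblock⟩ := exists_dyadic_block hX1 hlog le_rfl _ hsum' hX0
  set s := (Icc 1 X).filter (fun d => M ≤ d ∧ d < 2 * M) with hs
  have hM0 : (0 : ℝ) < M := by exact_mod_cast hM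
  have hblock0 : 0 < ∑ m ∈ s, ‖u m‖ * ‖G m‖ := lt_of_lt_of_le (by positivity) hblock
  set H := X / M with hH
  obtain ⟨hUM, hUH⟩ : U < 2 * M ∧ U < H := by
    obtain ⟨m, hm, hne⟩ := exists_ne_zero_of_sum_ne_zero hblock0.ne'
    simp only [hs, mem_filter, mem_Icc] at hm
    have h1 : U < m := by
      by_contra! h
      simp [hu0 m h] at hne
    refine ⟨by omega, ?_⟩
    have h2 : G m ≠ 0 := by
      intro h
      simp [h] at hne
    obtain ⟨n, hn, hne⟩ := exists_ne_zero_of_sum_ne_zero h2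
    have h3 : U < n := by
      by_contra! h
      simp [hv0 n h] at hne
    have h4 : X / m ≤ X / M := Nat.div_le_div_left hm.2.1 hM
    have := mem_Icc.1 hn
    omega
  have hMX : M ≤ X := by
    by_contra! h
    rw [hH, Nat.div_eq_of_lt h] at hUH
    omega
  have hHM : H * M ≤ X := Nat.div_mul_le_self _ _
  have hHM2 : X ≤ 2 * (H * M) := by
    have h1 := Nat.lt_div_mul_add (a := X) (b := M) (by omega)
    rw [← hH] at h1
    nlinarith
  have hX2 : (X : ℝ) ≤ 2 * (H * M) := by exact_mod_cast hHM2
  have hXM : (H : ℝ) * M ≤ X := by exact_mod_cast hHM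
  have hKC : K ^ (13 * C₁ + 1) ≤ (U : ℝ) := le_trans (pow_le_pow_right₀ hK1 (by omega)) hU
  have hUHr : (U : ℝ) ≤ H := by exact_mod_cast hUH.le
  have hUMr : (U : ℝ) ≤ 2 * M := by exact_mod_cast hUM.le
  have hH1 : 1 ≤ H := by omega
  have hH0 : (0 : ℝ) < H := by exact_mod_cast hH1
  -- Cauchy–Schwarz
  have htau : ∑ m ∈ s, ‖u m‖ ^ 2 ≤ 2 * M * K ^ 3 := by
    calc ∑ m ∈ s, ‖u m‖ ^ 2 ≤ ∑ m ∈ s, ((m.divisors.card : ℕ) : ℝ) ^ 2 :=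
          sum_le_sum fun m _ => pow_le_pow_left₀ (norm_nonneg _) (hu m) 2
      _ ≤ ∑ m ∈ Icc 1 (2 * M), ((m.divisors.card : ℕ) : ℝ) ^ 2 := by
          refine sum_le_sum_of_subset_of_nonneg ?_ fun _ _ _ => by positivity
          intro m hm
          simp only [hs, mem_filter, mem_Icc] at hm ⊢
          omega
      _ ≤ ((2 * M : ℕ) : ℝ) * (1 + Real.log ((2 * M : ℕ) : ℝ)) ^ 3 := sum_card_divisors_sq_le _
      _ ≤ _ := by
          push_cast
          have h1 : Real.log (2 * M) ≤ Real.log (2 * X) := by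
            refine Real.log_le_log (by positivity) ?_
            have : (M : ℝ) ≤ X := by exact_mod_cast hMX
            linarith
          have h2 : 0 ≤ Real.log (2 * M) := by
            have := Real.log_natCast_nonneg (2 * M)
            push_cast at this
            exact this
          gcongr
          linarith
  have hCS : (X : ℝ) ^ 2 / (8 * K ^ 7 * M) ≤ ∑ m ∈ s, ‖G m‖ ^ 2 := by
    have h1 := sum_mul_sq_le_sq_mul_sq s (fun m => ‖u m‖) (fun m => ‖G m‖)
    have h2 : ((X : ℝ) / (2 * K ^ 2)) ^ 2 ≤ (∑ m ∈ s, ‖u m‖ * ‖G m‖) ^ 2 :=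
      pow_le_pow_left₀ (by positivity) hblock 2
    have h3 : 0 ≤ ∑ m ∈ s, ‖G m‖ ^ 2 := sum_nonneg fun _ _ => by positivity
    have h4 : ((X : ℝ) / (2 * K ^ 2)) ^ 2 ≤ 2 * M * K ^ 3 * ∑ m ∈ s, ‖G m‖ ^ 2 :=
      h2.trans (h1.trans (mul_le_mul_of_nonneg_right htau h3))
    have h5 : (X : ℝ) ^ 2 / (8 * K ^ 7 * M) = ((X : ℝ) / (2 * K ^ 2)) ^ 2 / (2 * M * K ^ 3) := by
      field_simp
      norm_num
    rw [h5, div_le_iff₀ (by positivity)]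
    linarith
  set lo : ℕ × ℕ → ℕ := fun p => min (2 * M) (X / max p.1 p.2 + 1) with hlo
  set T : ℕ × ℕ → ℝ := fun p => ‖∑ m ∈ Ico M (lo p),
    apPhase f b W (p.1 * m) * (starRingEnd ℂ) (apPhase f b W (p.2 * m))‖ with hT
  have hexp : ∑ m ∈ s, ‖G m‖ ^ 2 ≤ ∑ p ∈ Icc 1 H ×ˢ Icc 1 H, K ^ 2 * T p := by
    have h1 : ∀ m ∈ s, ((‖G m‖ ^ 2 : ℝ) : ℂ) = ∑ p ∈ Icc 1 H ×ˢ Icc 1 H,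
        if m < lo p then v p.1 * (starRingEnd ℂ) (v p.2) *
          (apPhase f b W (p.1 * m) * (starRingEnd ℂ) (apPhase f b W (p.2 * m))) else 0 := by
      intro m hm
      simp only [hs, mem_filter, mem_Icc] at hm
      have h2 : X / m ≤ H := Nat.div_le_div_left hm.2.1 hM
      push_cast
      rw [← Complex.mul_conj', hG]
      simp only
      rw [map_sum, sum_mul_sum, ← sum_product', ← sum_filter]
      refine sum_congr ?_ fun p _ => by rw [map_mul]; ring
      ext p
      simp only [mem_product, mem_Icc, mem_filter, hlo, lt_min_iff, Nat.lt_succ_iff]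
      constructor
      · rintro ⟨⟨h3, h4⟩, h5, h6⟩
        refine ⟨⟨⟨h3, h4.trans h2⟩, h5, h6.trans h2⟩, hm.2.2, ?_⟩
        rw [Nat.le_div_iff_mul_le (by omega)] at h4 h6 ⊢
        rcases max_cases p.1 p.2 with h | h <;> rw [h.1, mul_comm] <;> assumption
      · rintro ⟨⟨⟨h3, h4⟩, h5, h6⟩, _, h7⟩
        rw [Nat.le_div_iff_mul_le (by omega)] at h7
        refine ⟨⟨h3, ?_⟩, h5, ?_⟩ <;> rw [Nat.le_div_iff_mul_le (by omega)] <;>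
          refine le_trans ?_ h7 <;> rw [mul_comm] <;> gcongr
        · exact le_max_left _ _
        · exact le_max_right _ _
    have h2 : ((∑ m ∈ s, ‖G m‖ ^ 2 : ℝ) : ℂ) = ∑ p ∈ Icc 1 H ×ˢ Icc 1 H,
        v p.1 * (starRingEnd ℂ) (v p.2) * ∑ m ∈ Ico M (lo p),
          apPhase f b W (p.1 * m) * (starRingEnd ℂ) (apPhase f b W (p.2 * m)) := by
      rw [Complex.ofReal_sum, sum_congr rfl h1, sum_comm]
      refine sum_congr rfl fun p hp => ?_
      rw [← sum_filter, mul_sum]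
      refine sum_congr ?_ fun _ _ => rfl
      ext m
      simp only [hs, mem_filter, mem_Icc, mem_Ico, hlo, lt_min_iff, Nat.lt_succ_iff]
      constructor
      · rintro ⟨⟨_, h3, _⟩, h4⟩
        exact ⟨h3, h4⟩
      · rintro ⟨h3, h4, h5⟩
        exact ⟨⟨⟨by omega, h5.trans (Nat.div_le_self _ _)⟩, h3, h4⟩, h4, h5⟩
    have h3 : ∑ m ∈ s, ‖G m‖ ^ 2 = ‖((∑ m ∈ s, ‖G m‖ ^ 2 : ℝ) : ℂ)‖ := by
      rw [Complex.norm_real, Real.norm_of_nonneg]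
      exact sum_nonneg fun _ _ => by positivity
    rw [h3, h2]
    refine (norm_sum_le _ _).trans (sum_le_sum fun p hp => ?_)
    simp only [mem_product, mem_Icc] at hp
    have hHX : H ≤ X := Nat.div_le_self _ _
    rw [norm_mul, norm_mul, RCLike.norm_conj, sq]
    gcongr
    · exact hv _ (hp.1.2.trans hHX)
    · exact hv _ (hp.2.2.trans hHX)
  have hTsum : (H : ℝ) ^ 2 * M / (8 * K ^ 9) ≤ ∑ p ∈ Icc 1 H ×ˢ Icc 1 H, T p := by
    rw [← mul_sum] at hexp
    have h1 := hCS.trans hexp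
    have h2 : (H : ℝ) ^ 2 * M / (8 * K ^ 7) ≤ (X : ℝ) ^ 2 / (8 * K ^ 7 * M) := by
      rw [div_le_div_iff₀ (by positivity) (by positivity)]
      have : ((H : ℝ) * M) ^ 2 ≤ (X : ℝ) ^ 2 := pow_le_pow_left₀ (by positivity) hXM 2
      have h3 : 0 < 8 * K ^ 7 := by positivity
      nlinarith
    have h3 : (H : ℝ) ^ 2 * M / (8 * K ^ 9) = (H : ℝ) ^ 2 * M / (8 * K ^ 7) / K ^ 2 := by
      field_simp
    rw [h3, div_le_iff₀ (by positivity)]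
    linarith
  have hlen : ∀ p, lo p ≤ M + M := fun p => (min_le_left _ _).trans (by omega)
  have hpop := exists_popular (s := Icc 1 H ×ˢ Icc 1 H) (f := T) (K := 8 * K ^ 9)
    (n := (H : ℝ) ^ 2) (B := M) (by positivity) hM0 (by simp [sq])
    (fun p _ => norm_sum_Ico_le (fun m => by
      rw [norm_mul, RCLike.norm_conj]
      exact mul_le_one₀ (norm_apPhase_le _ _ _ _) (norm_nonneg _) (norm_apPhase_le _ _ _ _))
      (hlen p)) hTsum
  have hK16 : 2 * (8 * K ^ 9) ≤ K ^ 13 := by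
    have : (2 : ℝ) ^ 4 ≤ K ^ 4 := pow_le_pow_left₀ (by norm_num) hK 4
    have h9 : 0 < K ^ 9 := by positivity
    calc 2 * (8 * K ^ 9) = 2 ^ 4 * K ^ 9 := by ring
      _ ≤ K ^ 4 * K ^ 9 := by gcongr
      _ = _ := by ring
  have hUC : 2 * (K ^ 13) ^ C₁ ≤ U := by
    refine le_trans ?_ hKC
    rw [← pow_mul, pow_succ, mul_comm]
    gcongr
  have hC0 : 0 < (K ^ 13) ^ C₁ := by positivity
  obtain ⟨Q, hQ1, hQ2, hQ3⟩ := hC₁ (K ^ 13) (hK.trans (le_self_pow₀ hK1 (by norm_num))) β f hf b W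
    hW hbW H M ((Icc 1 H ×ˢ Icc 1 H).filter _) (by linarith) (by linarith)
    (filter_subset _ _) (le_trans (by gcongr) hpop)
    (fun p hp => by
      rw [mem_filter] at hp
      refine ⟨M, lo p, hlen p, le_trans ?_ hp.2⟩
      gcongr)
  refine ⟨Q, hQ1, hQ2.trans ?_, hQ3.mono ?_⟩
  · rw [← pow_mul]
    exact pow_le_pow_right₀ hK1 (by omega)
  · rw [div_le_div_iff₀ (by positivity) (by positivity), ← pow_mul]
    calc K ^ (13 * C₁) * (X : ℝ) ^ (k + 1)
        ≤ K ^ (13 * C₁ + 1) * (2 * (H * M)) ^ (k + 1) := by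
          gcongr
          · omega
      _ ≤ K ^ (13 * C₁ + 1) * (K ^ (k + 1) * (H * M) ^ (k + 1)) := by
          rw [mul_pow]
          gcongr
      _ = _ := by ring

section VonMangoldt

open scoped ArithmeticFunction.vonMangoldt ArithmeticFunction.Moebius ArithmeticFunction.zeta

/-- The restriction of an arithmetic function to the integers `n ≤ U`. -/
def lowPart (g : ArithmeticFunction ℝ) (U : ℕ) : ArithmeticFunction ℝ :=
  ⟨fun n => if n ≤ U then g n else 0, by simp⟩

lemma lowPart_apply (g : ArithmeticFunction ℝ) (U n : ℕ) :
    lowPart g U n = if n ≤ U then g n else 0 := rfl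

lemma sub_lowPart_apply (g : ArithmeticFunction ℝ) (U n : ℕ) :
    (g - lowPart g U) n = if n ≤ U then 0 else g n := by
  rw [sub_eq_add_neg, ArithmeticFunction.add_apply, ArithmeticFunction.neg_apply, lowPart_apply]
  split_ifs <;> ring

lemma vaughan_identity (U : ℕ) : Λ = lowPart Λ U + lowPart μ U * ArithmeticFunction.log
    - (lowPart μ U * lowPart Λ U) * (ζ : ArithmeticFunction ℝ)
    + (((μ : ArithmeticFunction ℝ) - lowPart μ U) * (ζ : ArithmeticFunction ℝ)) *
      (Λ - lowPart Λ U) := by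
  have h1 : Λ * (ζ : ArithmeticFunction ℝ) = ArithmeticFunction.log :=
    ArithmeticFunction.vonMangoldt_mul_zeta
  have h2 : (μ : ArithmeticFunction ℝ) * (ζ : ArithmeticFunction ℝ) = 1 :=
    ArithmeticFunction.coe_moebius_mul_coe_zeta
  linear_combination (lowPart Λ U - Λ) * h2 + lowPart μ U * h1

lemma sum_mul_arith (g h : ArithmeticFunction ℝ) (F : ℕ → ℂ) (X : ℕ) :
    ∑ n ∈ Icc 1 X, ((g * h) n : ℂ) * F n =
      ∑ d ∈ Icc 1 X, (g d : ℂ) * ∑ l ∈ Icc 1 (X / d), (h l : ℂ) * F (d * l) := by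
  simp_rw [mul_sum]
  rw [← sum_divisorsAntidiagonal_eq X (fun d l => (g d : ℂ) * ((h l : ℂ) * F (d * l)))]
  refine sum_congr rfl fun n _ => ?_
  rw [ArithmeticFunction.mul_apply]
  push_cast
  rw [sum_mul]
  refine sum_congr rfl fun p hp => ?_
  rw [(Nat.mem_divisorsAntidiagonal.1 hp).1]
  ring

lemma abs_coe_moebius_le (n : ℕ) : |(μ : ArithmeticFunction ℝ) n| ≤ 1 := by
  rw [ArithmeticFunction.intCoe_apply]
  exact_mod_cast ArithmeticFunction.abs_moebius_le_one (n := n)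

lemma norm_sum_log_mul_le (g : ℕ → ℂ) (n : ℕ) : ∃ j, 1 ≤ j ∧
    ‖∑ l ∈ Icc 1 n, (Real.log l : ℂ) * g l‖ ≤
      Real.log n * ‖∑ l ∈ Ico j (n + 1), g l‖ := by
  rcases Nat.eq_zero_or_pos n with rfl | hn
  · exact ⟨1, le_rfl, by simp⟩
  obtain ⟨j, hj, hmax⟩ := exists_max_image (Icc 1 n) (fun j => ‖∑ l ∈ Ico j (n + 1), g l‖)
    ⟨1, by simp; omega⟩
  refine ⟨j, (mem_Icc.1 hj).1, ?_⟩
  have htel : ∀ l : ℕ, ∑ i ∈ Icc 1 l, (Real.log i - Real.log ((i - 1 : ℕ) : ℝ)) = Real.log l := by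
    intro l
    induction l with
    | zero => simp
    | succ l ih =>
      rw [sum_Icc_succ_top (by omega), ih]
      simp
  have hnn : ∀ i ∈ Icc 1 n, 0 ≤ Real.log i - Real.log ((i - 1 : ℕ) : ℝ) := by
    intro i hi
    rcases Nat.lt_or_ge 1 i with h | h
    · rw [sub_nonneg]
      refine Real.log_le_log ?_ (by exact_mod_cast Nat.sub_le _ _)
      exact_mod_cast (by omega)
    · have : i = 1 := by have := mem_Icc.1 hi; omega
      simp [this]
  have hswap : ∑ l ∈ Icc 1 n, (Real.log l : ℂ) * g l =
      ∑ i ∈ Icc 1 n, ((Real.log i - Real.log ((i - 1 : ℕ) : ℝ) : ℝ) : ℂ) *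
        ∑ l ∈ Ico i (n + 1), g l := by
    calc _ = ∑ l ∈ Icc 1 n, ∑ i ∈ Icc 1 l,
          ((Real.log i - Real.log ((i - 1 : ℕ) : ℝ) : ℝ) : ℂ) * g l := by
          refine sum_congr rfl fun l _ => ?_
          rw [← sum_mul, ← Complex.ofReal_sum, htel]
      _ = ∑ i ∈ Icc 1 n, ∑ l ∈ Ico i (n + 1),
          ((Real.log i - Real.log ((i - 1 : ℕ) : ℝ) : ℝ) : ℂ) * g l := by
          refine sum_comm' fun l i => ?_
          simp only [mem_Icc, mem_Ico]
          omega
      _ = _ := by simp_rw [mul_sum]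
  rw [hswap]
  calc _ ≤ ∑ i ∈ Icc 1 n, (Real.log i - Real.log ((i - 1 : ℕ) : ℝ)) *
        ‖∑ l ∈ Ico j (n + 1), g l‖ := by
        refine (norm_sum_le _ _).trans (sum_le_sum fun i hi => ?_)
        rw [norm_mul, Complex.norm_real, Real.norm_of_nonneg (hnn i hi)]
        exact mul_le_mul_of_nonneg_left (hmax i hi) (hnn i hi)
    _ = _ := by rw [← sum_mul, htel]

lemma norm_sum_mul_le_of_support {c R : ℕ → ℂ} {B : ℝ} {X V : ℕ} (hVX : V ≤ X)
    (hc0 : ∀ d, V < d → c d = 0) (hc : ∀ d ≤ X, ‖c d‖ ≤ B) :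
    ‖∑ d ∈ Icc 1 X, c d * R d‖ ≤ B * ∑ d ∈ Icc 1 V, ‖R d‖ := by
  have : ∑ d ∈ Icc 1 X, c d * R d = ∑ d ∈ Icc 1 V, c d * R d := by
    symm
    refine sum_subset (Icc_subset_Icc le_rfl hVX) fun d hd hd' => ?_
    rw [hc0 d, zero_mul]
    rw [mem_Icc] at hd hd'
    omega
  rw [this, mul_sum]
  refine (norm_sum_le _ _).trans (sum_le_sum fun d hd => ?_)
  rw [norm_mul]
  exact mul_le_mul_of_nonneg_right (hc d ((mem_Icc.1 hd).2.trans hVX)) (norm_nonneg _)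

lemma abs_lowPart_mul_lowPart_le (U t : ℕ) :
    |(lowPart μ U * lowPart Λ U) t| ≤ Real.log t := by
  rw [ArithmeticFunction.mul_apply]
  calc _ ≤ ∑ p ∈ t.divisorsAntidiagonal, Λ p.2 := by
        refine (abs_sum_le_sum_abs _ _).trans (sum_le_sum fun p _ => ?_)
        rw [abs_mul, lowPart_apply, lowPart_apply]
        have h1 := abs_coe_moebius_le p.1
        have h2 : 0 ≤ Λ p.2 := ArithmeticFunction.vonMangoldt_nonneg
        split_ifs
        · rw [abs_of_nonneg h2]
          nlinarith
        · simp
        · simp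
        · simp
    _ = Real.log t := by
        rw [← ArithmeticFunction.vonMangoldt_sum, ← Nat.map_div_left_divisors, sum_map]
        rfl

lemma lowPart_mul_lowPart_eq_zero {U t : ℕ} (ht : U ^ 2 < t) :
    (lowPart μ U * lowPart Λ U) t = 0 := by
  rw [ArithmeticFunction.mul_apply]
  refine sum_eq_zero fun p hp => ?_
  have hp := (Nat.mem_divisorsAntidiagonal.1 hp).1
  rw [lowPart_apply, lowPart_apply]
  split_ifs with h1 h2
  · have := Nat.mul_le_mul h1 h2
    rw [hp, ← sq] at this
    omega
  all_goals simp

lemma abs_sub_lowPart_mul_zeta_le (U m : ℕ) :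
    |(((μ : ArithmeticFunction ℝ) - lowPart μ U) * (ζ : ArithmeticFunction ℝ)) m| ≤
      (m.divisors.card : ℕ) := by
  rw [ArithmeticFunction.coe_mul_zeta_apply]
  refine (abs_sum_le_sum_abs _ _).trans ?_
  calc _ ≤ ∑ _i ∈ m.divisors, (1 : ℝ) := by
        refine sum_le_sum fun i _ => ?_
        rw [sub_lowPart_apply]
        split_ifs
        · simp
        · exact abs_coe_moebius_le i
    _ = _ := by simp

lemma sub_lowPart_mul_zeta_eq_zero {U m : ℕ} (hm : m ≤ U) :
    (((μ : ArithmeticFunction ℝ) - lowPart μ U) * (ζ : ArithmeticFunction ℝ)) m = 0 := by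
  rw [ArithmeticFunction.coe_mul_zeta_apply]
  refine sum_eq_zero fun i hi => ?_
  rw [sub_lowPart_apply, if_pos ((Nat.divisor_le hi).trans hm)]

theorem vonMangoldt_inverse (k : ℕ) : ∃ C : ℕ, ∀ K : ℝ, 2 ≤ K → ∀ (β : ℝ) (f : ℝ → ℝ),
    PolyPhase (k + 1) β f → ∀ b W : ℕ, 1 ≤ W → Nat.gcd b W = 1 →
    ∀ X : ℕ, 1 + Real.log (2 * X) ≤ K → K ^ C ≤ (X : ℝ) →
    (X : ℝ) / K ≤ ‖∑ n ∈ Icc 1 X, (Λ n : ℂ) * apPhase f b W n‖ →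
    ∃ Q : ℕ, 1 ≤ Q ∧ (Q : ℝ) ≤ K ^ C ∧ NearInt (Q * β) (K ^ C / (X : ℝ) ^ (k + 1)) := by
  obtain ⟨C₁, hC₁⟩ := typeI_sum k
  obtain ⟨C₂, hC₂⟩ := typeII_sum k
  refine ⟨4 * C₁ + 8 * C₂ + 6, fun K hK β f hf b W hW hbW X hlog hX hsum => ?_⟩
  have hK1 : (1 : ℝ) ≤ K := by linarith
  have hK0 : (0 : ℝ) < K := by linarith
  have hK4 : K ≤ K ^ 4 := le_self_pow₀ hK1 (by norm_num)
  have hK24 : 2 ≤ K ^ 4 := hK.trans hK4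
  have hlog4 : 1 + Real.log (2 * X) ≤ K ^ 4 := hlog.trans hK4
  have hX1' : (1 : ℝ) ≤ X := (one_le_pow₀ hK1).trans hX
  have hX1 : 1 ≤ X := by exact_mod_cast hX1'
  have hX0 : (0 : ℝ) < X := by linarith
  have hlogn : ∀ n ≤ X, Real.log n ≤ K := by
    intro n hn
    rcases Nat.eq_zero_or_pos n with rfl | hn0
    · simp [hK0.le]
    · have : Real.log n ≤ Real.log (2 * X) := by
        refine Real.log_le_log (by exact_mod_cast hn0) ?_
        have : (n : ℝ) ≤ X := by exact_mod_cast hn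
        linarith
      linarith
  set U := ⌈(K ^ 4) ^ C₂⌉₊ with hU
  have hUlo : (K ^ 4) ^ C₂ ≤ (U : ℝ) := Nat.le_ceil _
  have hU1' : (1 : ℝ) ≤ U := (one_le_pow₀ (one_le_pow₀ hK1)).trans hUlo
  have hU1 : 1 ≤ U := by exact_mod_cast hU1'
  have hUhi : (U : ℝ) ≤ K ^ (4 * C₂ + 1) := by
    have h1 := (Nat.ceil_lt_add_one (show 0 ≤ (K ^ 4) ^ C₂ by positivity)).le
    rw [← hU, ← pow_mul] at h1
    rw [pow_succ]
    have := one_le_pow₀ hK1 (n := 4 * C₂)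
    nlinarith
  have hVhi : ((U ^ 2 : ℕ) : ℝ) ≤ K ^ (8 * C₂ + 2) := by
    push_cast
    calc (U : ℝ) ^ 2 ≤ (K ^ (4 * C₂ + 1)) ^ 2 := by gcongr
      _ = _ := by ring
  have hVX' : (K ^ 4) ^ C₁ * ((U ^ 2 : ℕ) : ℝ) ≤ X := by
    refine le_trans ?_ hX
    calc (K ^ 4) ^ C₁ * ((U ^ 2 : ℕ) : ℝ) ≤ (K ^ 4) ^ C₁ * K ^ (8 * C₂ + 2) := by gcongr
      _ = K ^ (4 * C₁ + 8 * C₂ + 2) := by ring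
      _ ≤ _ := pow_le_pow_right₀ hK1 (by omega)
  have hVX : U ^ 2 ≤ X := by
    have : ((U ^ 2 : ℕ) : ℝ) ≤ X := by
      refine le_trans ?_ hVX'
      exact le_mul_of_one_le_left (by positivity) (one_le_pow₀ (one_le_pow₀ hK1))
    exact_mod_cast this
  have hUV : U ≤ U ^ 2 := Nat.le_self_pow (by norm_num) U
  have hfin : (∃ Q : ℕ, 1 ≤ Q ∧ (Q : ℝ) ≤ (K ^ 4) ^ C₁ ∧
      NearInt (Q * β) ((K ^ 4) ^ C₁ / (X : ℝ) ^ (k + 1))) ∨ (∃ Q : ℕ, 1 ≤ Q ∧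
      (Q : ℝ) ≤ (K ^ 4) ^ C₂ ∧ NearInt (Q * β) ((K ^ 4) ^ C₂ / (X : ℝ) ^ (k + 1))) →
      ∃ Q : ℕ, 1 ≤ Q ∧ (Q : ℝ) ≤ K ^ (4 * C₁ + 8 * C₂ + 6) ∧
        NearInt (Q * β) (K ^ (4 * C₁ + 8 * C₂ + 6) / (X : ℝ) ^ (k + 1)) := by
    have h1 : (K ^ 4) ^ C₁ ≤ K ^ (4 * C₁ + 8 * C₂ + 6) := by
      rw [← pow_mul]; exact pow_le_pow_right₀ hK1 (by omega)
    have h2 : (K ^ 4) ^ C₂ ≤ K ^ (4 * C₁ + 8 * C₂ + 6) := by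
      rw [← pow_mul]; exact pow_le_pow_right₀ hK1 (by omega)
    rintro (⟨Q, hQ1, hQ2, hQ3⟩ | ⟨Q, hQ1, hQ2, hQ3⟩)
    · exact ⟨Q, hQ1, hQ2.trans h1, hQ3.mono (by gcongr)⟩
    · exact ⟨Q, hQ1, hQ2.trans h2, hQ3.mono (by gcongr)⟩
  apply hfin
  set F := apPhase f b W with hF
  have hF1 : ∀ n, ‖F n‖ ≤ 1 := norm_apPhase_le f b W
  by_contra! hcon
  obtain ⟨hcon₁, hcon₂⟩ := hcon
  have hI : ∀ j : ℕ → ℕ, (∀ d, 1 ≤ j d) →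
      ∑ d ∈ Icc 1 (U ^ 2), ‖∑ l ∈ Ico (j d) (X / d + 1), F (d * l)‖ < X / K ^ 4 := by
    intro j hj
    by_contra! h
    obtain ⟨Q, hQ1, hQ2, hQ3⟩ := hC₁ (K ^ 4) hK24 β f hf b W hW hbW X (U ^ 2)
      (hU1.trans hUV) hlog4 hVX' j hj h
    exact hcon₁ Q hQ1 hQ2 hQ3
  have hKX : K * (X / K ^ 4) ≤ X / (4 * K) := by
    rw [mul_div_assoc', div_le_div_iff₀ (by positivity) (by positivity)]
    have h2 : 4 * K ^ 2 ≤ K ^ 4 := by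
      have : (2 : ℝ) ^ 2 ≤ K ^ 2 := pow_le_pow_left₀ (by norm_num) hK 2
      nlinarith
    nlinarith
  -- the four pieces of Vaughan's identity
  have hT₀ : ‖∑ n ∈ Icc 1 X, (lowPart Λ U n : ℂ) * F n‖ < X / (4 * K) := by
    have h1 := norm_sum_mul_le_of_support (c := fun n => (lowPart Λ U n : ℂ)) (R := F) (B := K)
      (hUV.trans hVX) (fun d hd => by simp [lowPart_apply, not_le.2 hd]) (fun d hd => by
        rw [Complex.norm_real, lowPart_apply]
        split_ifs
        · rw [Real.norm_of_nonneg ArithmeticFunction.vonMangoldt_nonneg]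
          exact ArithmeticFunction.vonMangoldt_le_log.trans (hlogn d hd)
        · simp [hK0.le])
    have h2 : ∑ d ∈ Icc 1 U, ‖F d‖ ≤ U := by
      calc _ ≤ ∑ _d ∈ Icc 1 U, (1 : ℝ) := sum_le_sum fun d _ => hF1 d
        _ = _ := by simp
    have h3 : K * (U * (4 * K)) < X := by
      refine lt_of_lt_of_le ?_ hX
      calc K * (U * (4 * K)) ≤ K * (K ^ (4 * C₂ + 1) * (4 * K)) := by gcongr
        _ = 4 * K ^ (4 * C₂ + 3) := by ring
        _ < K ^ 3 * K ^ (4 * C₂ + 3) := by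
          gcongr
          have : (2 : ℝ) ^ 3 ≤ K ^ 3 := pow_le_pow_left₀ (by norm_num) hK 3
          linarith
        _ = K ^ (4 * C₂ + 6) := by ring
        _ ≤ _ := pow_le_pow_right₀ hK1 (by omega)
    refine lt_of_le_of_lt (h1.trans (mul_le_mul_of_nonneg_left h2 hK0.le)) ?_
    rw [lt_div_iff₀ (by positivity)]
    linarith
  have hT₁ : ‖∑ n ∈ Icc 1 X, ((lowPart μ U * ArithmeticFunction.log) n : ℂ) * F n‖
      < X / (4 * K) := by
    rw [sum_mul_arith]
    choose j hj1 hj2 using fun d => norm_sum_log_mul_le (fun l => F (d * l)) (X / d)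
    have h1 := norm_sum_mul_le_of_support (c := fun n => (lowPart μ U n : ℂ)) (B := 1)
      (R := fun d => ∑ l ∈ Icc 1 (X / d), ((ArithmeticFunction.log l : ℝ) : ℂ) * F (d * l)) hVX
      (fun d hd => by simp [lowPart_apply, not_le.2 (lt_of_le_of_lt hUV hd)]) (fun d hd => by
        rw [Complex.norm_real, lowPart_apply]
        split_ifs
        · exact abs_coe_moebius_le d
        · simp)
    refine lt_of_le_of_lt h1 (lt_of_lt_of_le ?_ hKX)
    rw [one_mul]
    calc _ ≤ ∑ d ∈ Icc 1 (U ^ 2), K * ‖∑ l ∈ Ico (j d) (X / d + 1), F (d * l)‖ := by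
          refine sum_le_sum fun d _ => (hj2 d).trans ?_
          exact mul_le_mul_of_nonneg_right (hlogn _ (Nat.div_le_self _ _)) (norm_nonneg _)
      _ < _ := by
          rw [← mul_sum]
          exact mul_lt_mul_of_pos_left (hI j hj1) hK0
  have hT₂ : ‖∑ n ∈ Icc 1 X, (((lowPart μ U * lowPart Λ U) * (ζ : ArithmeticFunction ℝ)) n : ℂ)
      * F n‖ < X / (4 * K) := by
    rw [sum_mul_arith]
    have h1 := norm_sum_mul_le_of_support (c := fun n => ((lowPart μ U * lowPart Λ U) n : ℂ))
      (B := K) (R := fun d => ∑ l ∈ Icc 1 (X / d),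
        (((ζ : ArithmeticFunction ℝ) l : ℝ) : ℂ) * F (d * l)) hVX
      (fun d hd => by simp [lowPart_mul_lowPart_eq_zero hd]) (fun d hd => by
        rw [Complex.norm_real]
        exact (abs_lowPart_mul_lowPart_le U d).trans (hlogn d hd))
    refine lt_of_le_of_lt h1 (lt_of_lt_of_le ?_ hKX)
    refine mul_lt_mul_of_pos_left (lt_of_le_of_lt (le_of_eq ?_) (hI (fun _ => 1)
      (fun _ => le_rfl))) hK0
    refine sum_congr rfl fun d _ => ?_
    congr 1
    refine sum_congr (by ext; simp) fun l hl => ?_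
    have : l ≠ 0 := by have := mem_Ico.1 hl; omega
    simp [ArithmeticFunction.natCoe_apply, ArithmeticFunction.zeta_apply, this]
  have hT₃ : ‖∑ n ∈ Icc 1 X, (((((μ : ArithmeticFunction ℝ) - lowPart μ U) *
      (ζ : ArithmeticFunction ℝ)) * (Λ - lowPart Λ U)) n : ℂ) * F n‖ < X / (4 * K) := by
    rw [sum_mul_arith]
    refine lt_of_lt_of_le ?_ (le_trans (le_mul_of_one_le_left (by positivity) hK1) hKX)
    by_contra! h
    obtain ⟨Q, hQ1, hQ2, hQ3⟩ := hC₂ (K ^ 4) hK24 β f hf b W hW hbW X U hX1 hlog4 hUlo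
      (fun m => ((((μ : ArithmeticFunction ℝ) - lowPart μ U) *
        (ζ : ArithmeticFunction ℝ)) m : ℂ)) (fun n => ((Λ - lowPart Λ U) n : ℂ))
      (fun m hm => by simp [sub_lowPart_mul_zeta_eq_zero hm])
      (fun n hn => by simp only [sub_lowPart_apply, if_pos hn, Complex.ofReal_zero])
      (fun m => by
        rw [Complex.norm_real]
        exact abs_sub_lowPart_mul_zeta_le U m)
      (fun n hn => by
        rw [Complex.norm_real, sub_lowPart_apply]
        split_ifs
        · simp only [norm_zero]; positivity
        · rw [Real.norm_of_nonneg ArithmeticFunction.vonMangoldt_nonneg]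
          exact ArithmeticFunction.vonMangoldt_le_log.trans ((hlogn n hn).trans hK4))
      (h.trans (le_of_eq (congrArg norm (sum_congr rfl fun m _ => congrArg _
        (sum_congr rfl fun n _ => by rw [mul_comm m n])))))
    exact hcon₂ Q hQ1 hQ2 hQ3
  have hsplit : ∑ n ∈ Icc 1 X, (Λ n : ℂ) * F n =
      ∑ n ∈ Icc 1 X, (lowPart Λ U n : ℂ) * F n +
      ∑ n ∈ Icc 1 X, ((lowPart μ U * ArithmeticFunction.log) n : ℂ) * F n -
      ∑ n ∈ Icc 1 X, (((lowPart μ U * lowPart Λ U) * (ζ : ArithmeticFunction ℝ)) n : ℂ) * F n +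
      ∑ n ∈ Icc 1 X, (((((μ : ArithmeticFunction ℝ) - lowPart μ U) *
        (ζ : ArithmeticFunction ℝ)) * (Λ - lowPart Λ U)) n : ℂ) * F n := by
    rw [← sum_add_distrib, ← sum_sub_distrib, ← sum_add_distrib]
    refine sum_congr rfl fun n _ => ?_
    nth_rw 1 [vaughan_identity U]
    rw [ArithmeticFunction.add_apply, sub_eq_add_neg, ArithmeticFunction.add_apply,
      ArithmeticFunction.add_apply, ArithmeticFunction.neg_apply]
    push_cast
    ring
  rw [hsplit] at hsum
  have h4 : (X : ℝ) / K = 4 * (X / (4 * K)) := by field_simp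
  have := (norm_add_le _ _).trans (add_le_add_left ((norm_sub_le _ _).trans
    (add_le_add_left (norm_add_le _ _) _)) _) |> hsum.trans
  linarith

lemma sum_mul_apPhase_eq {b W : ℕ} (hb : 1 ≤ b) (hbW : b ≤ W) (N : ℕ) (g : ℕ → ℂ) (f : ℝ → ℝ) :
    ∑ n ∈ Icc 1 (W * N + b), g n * apPhase f b W n =
      ∑ x ∈ range (N + 1), g (W * x + b) * eC (f x) := by
  have hW : 0 < W := by omega
  simp only [apPhase, mul_ite, mul_zero]
  rw [← sum_filter]
  symm
  refine sum_bij (fun x _ => W * x + b) ?_ ?_ ?_ ?_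
  · intro x hx
    rw [mem_range, Nat.lt_succ_iff] at hx
    simp only [mem_filter, mem_Icc]
    refine ⟨⟨by omega, by gcongr⟩, ?_⟩
    simp [Nat.ModEq]
  · intro x _ y _ h
    exact Nat.eq_of_mul_eq_mul_left hW (by omega)
  · intro n hn
    simp only [mem_filter, mem_Icc] at hn
    obtain ⟨⟨h1, h2⟩, h3⟩ := hn
    have hle : b ≤ n := by
      by_contra! h
      have h4 : n % W = n := Nat.mod_eq_of_lt (by omega)
      rw [Nat.ModEq, h4] at h3
      rcases hbW.lt_or_eq with h5 | h5
      · rw [Nat.mod_eq_of_lt h5] at h3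
        omega
      · rw [h5, Nat.mod_self] at h3
        omega
    obtain ⟨x, hx⟩ := (Nat.modEq_iff_dvd' hle).1 h3.symm
    refine ⟨x, ?_, by omega⟩
    rw [mem_range, Nat.lt_succ_iff]
    exact Nat.le_of_mul_le_mul_left (by omega) hW
  · intro x _
    congr 3
    have : (W : ℝ) ≠ 0 := by exact_mod_cast hW.ne'
    push_cast
    field_simp
    ring

lemma norm_sum_vonMangoldt_sub_le (F : ℕ → ℂ) (hF : ∀ n, ‖F n‖ ≤ 1) {X : ℕ} (hX : 1 ≤ X) :
    ‖∑ n ∈ Icc 1 X, ((if n.Prime then Real.log n else 0 : ℝ) : ℂ) * F n‖ ≤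
      ‖∑ n ∈ Icc 1 X, (Λ n : ℂ) * F n‖ + 2 * √X * Real.log X := by
  have hdiff : ∀ n, 0 ≤ Λ n - (if n.Prime then Real.log n else 0) := by
    intro n
    split_ifs with h
    · rw [ArithmeticFunction.vonMangoldt_apply_prime h, sub_self]
    · simp
  have hsum : ∑ n ∈ Icc 1 X, (Λ n - (if n.Prime then Real.log n else 0)) ≤
      2 * √X * Real.log X := by
    have h := Chebyshev.psi_sub_theta_le (x := (X : ℝ)) (by exact_mod_cast hX)
    rw [Chebyshev.psi, Chebyshev.theta, Nat.floor_natCast, sum_filter, ← sum_sub_distrib] at h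
    exact h
  have heq : ∑ n ∈ Icc 1 X, ((if n.Prime then Real.log n else 0 : ℝ) : ℂ) * F n =
      ∑ n ∈ Icc 1 X, (Λ n : ℂ) * F n -
        ∑ n ∈ Icc 1 X, ((Λ n - (if n.Prime then Real.log n else 0) : ℝ) : ℂ) * F n := by
    rw [← sum_sub_distrib]
    refine sum_congr rfl fun n _ => ?_
    push_cast
    ring
  rw [heq]
  refine (norm_sub_le _ _).trans (add_le_add_right (le_trans ?_ hsum) _)
  refine (norm_sum_le _ _).trans (sum_le_sum fun n _ => ?_)
  rw [norm_mul, Complex.norm_real, Real.norm_of_nonneg (hdiff n)]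
  exact mul_le_of_le_one_right (hdiff n) (hF n)

lemma totient_div_le_one (W : ℕ) : (Nat.totient W : ℝ) / W ≤ 1 :=
  div_le_one_of_le₀ (by exact_mod_cast Nat.totient_le W) (Nat.cast_nonneg _)

lemma norm_sum_lam_le {b W : ℕ} (hb : 1 ≤ b) (hbW : b ≤ W) (N : ℕ) (f : ℝ → ℝ) :
    ‖∑ x ∈ Icc 1 N, (lam b W x : ℂ) * eC (f x)‖ ≤
      ‖∑ n ∈ Icc 1 (W * N + b), (Λ n : ℂ) * apPhase f b W n‖ +
        2 * √((W * N + b : ℕ) : ℝ) * Real.log ((W * N + b : ℕ) : ℝ) + Real.log W := by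
  set g : ℕ → ℂ := fun n => ((if n.Prime then Real.log n else 0 : ℝ) : ℂ) with hg
  have h1 := norm_sum_vonMangoldt_sub_le (apPhase f b W) (norm_apPhase_le f b W)
    (X := W * N + b) (by omega)
  rw [sum_mul_apPhase_eq hb hbW N g f, range_eq_Ico, sum_eq_sum_Ico_succ_bot (by omega)] at h1
  have h2 : ∑ x ∈ Icc 1 N, (lam b W x : ℂ) * eC (f x) =
      (((Nat.totient W : ℝ) / W : ℝ) : ℂ) *
        ∑ x ∈ Ico (0 + 1) (N + 1), g (W * x + b) * eC (f x) := by
    rw [mul_sum]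
    refine sum_congr (by ext; simp) fun x _ => ?_
    simp only [lam, hg]
    split_ifs
    · push_cast
      ring
    · simp
  rw [h2, norm_mul, Complex.norm_real, Real.norm_of_nonneg (by positivity)]
  have h3 : ‖g (W * 0 + b) * eC (f (0 : ℕ))‖ ≤ Real.log W := by
    have hlog0 : Real.log b ≤ Real.log W :=
      Real.log_le_log (by exact_mod_cast hb) (by exact_mod_cast hbW)
    rw [norm_mul, norm_eC, mul_one, mul_zero, zero_add]
    simp only [hg]
    rw [Complex.norm_real]
    split_ifs
    · rwa [Real.norm_of_nonneg (Real.log_natCast_nonneg b)]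
    · simpa using Real.log_natCast_nonneg W
  set S := ∑ x ∈ Ico (0 + 1) (N + 1), g (W * x + b) * eC (f x)
  have h4 : ‖S‖ ≤ ‖g (W * 0 + b) * eC (f (0 : ℕ)) + S‖ + ‖g (W * 0 + b) * eC (f (0 : ℕ))‖ := by
    have := norm_sub_le (g (W * 0 + b) * eC (f (0 : ℕ)) + S) (g (W * 0 + b) * eC (f (0 : ℕ)))
    rwa [add_sub_cancel_left] at this
  have h5 : (Nat.totient W : ℝ) / W * ‖S‖ ≤ ‖S‖ :=
    mul_le_of_le_one_left (norm_nonneg _) (totient_div_le_one W)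
  linarith

lemma one_le_of_nearInt {α ε : ℝ} {a q R : ℕ} (haq : Nat.gcd a q = 1) (hR : 1 ≤ R)
    (hRq : 2 * R ≤ q) (hα : |α - (a : ℝ) / q| ≤ ((q : ℝ) ^ 2)⁻¹) (h : NearInt (R * α) ε) :
    1 ≤ 2 * q * ε := by
  obtain ⟨n, hn⟩ := h
  have hq0 : (0 : ℝ) < q := by exact_mod_cast (by omega)
  have hz : (R * a - n * q : ℤ) ≠ 0 := by
    intro h0
    have h1 : (q : ℤ) ∣ R * a := ⟨n, by linarith⟩
    have h2 : q ∣ R * a := by exact_mod_cast h1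
    have h3 := Nat.le_of_dvd (by omega) ((Nat.Coprime.symm haq).dvd_of_dvd_mul_right h2)
    omega
  have hz1 : (1 : ℝ) ≤ |(R * a - n * q : ℝ)| := by exact_mod_cast Int.one_le_abs hz
  have h1 : |(R * a - n * q : ℝ)| ≤ q * (ε + R * ((q : ℝ) ^ 2)⁻¹) := by
    have : (R * a - n * q : ℝ) = q * ((R * α - n) - R * (α - a / q)) := by
      field_simp
      ring
    rw [this, abs_mul, abs_of_pos hq0]
    gcongr
    refine (abs_sub _ _).trans (add_le_add hn ?_)
    rw [abs_mul, Nat.abs_cast]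
    gcongr
  have h2 : q * (R * ((q : ℝ) ^ 2)⁻¹) ≤ 1 / 2 := by
    have : (2 * R : ℝ) ≤ q := by exact_mod_cast hRq
    rw [show q * (R * ((q : ℝ) ^ 2)⁻¹) = R / q by field_simp, div_le_div_iff₀ hq0 (by norm_num)]
    linarith
  nlinarith

lemma eval_le_sum_abs_coeff_mul (P : Polynomial ℤ) {N : ℕ} (hN : 1 ≤ N) :
    ((P.eval (N : ℤ) : ℤ) : ℝ) ≤
      (∑ i ∈ range (P.natDegree + 1), |(P.coeff i : ℝ)|) * (N : ℝ) ^ P.natDegree := by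
  have hN1 : (1 : ℝ) ≤ N := by exact_mod_cast hN
  rw [Polynomial.eval_eq_sum_range, sum_mul]
  push_cast
  refine sum_le_sum fun i hi => ?_
  have hi : i ≤ P.natDegree := by simpa [Nat.lt_succ_iff] using hi
  gcongr
  · exact le_abs_self _

lemma exists_log_threshold (c : ℝ) (m : ℕ) : ∃ N₀ : ℕ, ∀ N : ℕ, N₀ ≤ N →
    c ≤ Real.log N ∧ Real.log N ^ m ≤ N := by
  have h1 := (Real.tendsto_log_atTop.comp tendsto_natCast_atTop_atTop).eventually_ge_atTop c
  have h2 := tendsto_natCast_atTop_atTop.eventually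
    ((Real.isLittleO_pow_log_id_atTop (n := m)).bound one_pos)
  obtain ⟨N₀, hN₀⟩ := Filter.eventually_atTop.1 (h1.and h2)
  refine ⟨N₀, fun N hN => ⟨(hN₀ N hN).1, ?_⟩⟩
  have := (hN₀ N hN).2
  rw [one_mul, id, Real.norm_of_nonneg (Nat.cast_nonneg N)] at this
  exact (le_abs_self _).trans this

end VonMangoldt

lemma norm_sum_lam_le_trivial {b W N : ℕ} (hb : 1 ≤ b) (hbW : b ≤ W) (hWN : W ≤ N) (hN : 2 ≤ N)
    (g : ℕ → ℝ) :
    ‖∑ x ∈ Icc 1 N, (lam b W x : ℂ) * eC (g x)‖ ≤ 3 * N * Real.log N := by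
  have hterm : ∀ x ∈ Icc 1 N, ‖(lam b W x : ℂ) * eC (g x)‖ ≤ 3 * Real.log N := by
    intro x hx
    rw [mem_Icc] at hx
    rw [norm_mul, norm_eC, mul_one, Complex.norm_real]
    have hlogN : 0 ≤ Real.log N := Real.log_natCast_nonneg N
    unfold lam
    split_ifs
    · have hnat : W * x + b ≤ N ^ 3 := by nlinarith [Nat.mul_le_mul hWN hx.2]
      have hle : ((W : ℝ) * x + b) ≤ (N : ℝ) ^ 3 := by exact_mod_cast hnat
      have hone : (1 : ℝ) ≤ (W : ℝ) * x + b := by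
        have : 1 ≤ W * x + b := by omega
        exact_mod_cast this
      have hlog : Real.log ((W : ℝ) * x + b) ≤ 3 * Real.log N := by
        have := Real.log_le_log (by linarith) hle
        rwa [Real.log_pow] at this
      have h0 := Real.log_nonneg hone
      rw [Real.norm_of_nonneg (by positivity)]
      exact (mul_le_of_le_one_left h0 (totient_div_le_one W)).trans hlog
    · simpa using hlogN
  refine (norm_sum_le_of_le _ hterm).trans (le_of_eq ?_)
  simp
  ring

lemma div_pow_log_le {N X W : ℝ} (A : ℕ) (hN : 1 ≤ N) (hL : 2 ≤ Real.log N) (hW : 1 ≤ W)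
    (hWL : W ≤ Real.log N) (hNX : N ≤ X) (hX : X ≤ 2 * W * N)
    (hpow : Real.log N ^ (2 * (A + 7)) ≤ N) :
    X / Real.log N ^ (A + 3) + 2 * √X * Real.log X + Real.log W ≤ N / Real.log N ^ A := by
  have hlogN := Real.log_le_sub_one_of_pos (show 0 < N by linarith)
  have hlog3 : Real.log X ≤ 3 * Real.log N := by
    have : X ≤ N ^ 3 := by
      have : 2 * W ≤ N ^ 2 := by nlinarith
      nlinarith
    have := Real.log_le_log (by linarith) this
    rwa [Real.log_pow] at this
  have hlogX : 0 ≤ Real.log X := Real.log_nonneg (by linarith)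
  have hlogW : Real.log W ≤ Real.log N :=
    (Real.log_le_sub_one_of_pos (by linarith)).trans (by linarith)
  set L := Real.log N with hLdef
  have hXL : X ≤ 2 * L * N := hX.trans (by gcongr)
  have hs0 := Real.sqrt_nonneg N
  have hs2 := Real.sq_sqrt (show 0 ≤ N by linarith)
  have hsX : √X ≤ 2 * L * √N := by
    rw [Real.sqrt_le_left (by positivity), mul_pow, hs2]
    refine hXL.trans ?_
    gcongr
    nlinarith
  have hsN : L ^ (A + 7) ≤ √N := by
    apply Real.le_sqrt_of_sq_le
    rwa [← pow_mul, mul_comm]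
  have hs1 : 1 ≤ √N := Real.one_le_sqrt.2 hN
  have h1 : 2 * √X * Real.log X + Real.log W ≤ 13 * L ^ 2 * √N := by
    have h2 : √X * Real.log X ≤ 2 * L * √N * (3 * L) := by gcongr
    have h3 : L ≤ L ^ 2 * √N := by
      nlinarith [mul_le_mul (show 1 ≤ L by linarith) hs1 zero_le_one (by linarith)]
    nlinarith
  have hA0 : (0 : ℝ) < L ^ A := by positivity
  have h2 : 13 * L ^ 2 * √N ≤ N / L ^ A / 2 := by
    rw [le_div_iff₀ two_pos, le_div_iff₀ hA0]
    have h5 : (26 : ℝ) ≤ L ^ 5 := by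
      have := pow_le_pow_left₀ zero_le_two hL 5
      linarith
    calc 13 * L ^ 2 * √N * 2 * L ^ A = 26 * (L ^ (A + 2) * √N) := by ring
      _ ≤ L ^ 5 * (L ^ (A + 2) * √N) := by gcongr
      _ = L ^ (A + 7) * √N := by ring
      _ ≤ √N * √N := by gcongr
      _ = N := by rw [← sq, hs2]
  have h3 : X / L ^ (A + 3) ≤ N / L ^ A / 2 := by
    rw [div_div, div_le_div_iff₀ (by positivity) (by positivity)]
    calc X * (L ^ A * 2) ≤ (2 * L * N) * (L ^ A * 2) := by gcongr
      _ = N * L ^ (A + 1) * 2 ^ 2 := by ring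
      _ ≤ N * L ^ (A + 1) * L ^ 2 := by gcongr
      _ = N * L ^ (A + 3) := by ring
  linarith

lemma one_add_log_two_mul_le {N X W : ℝ} (hN : 1 ≤ N) (hL : 2 ≤ Real.log N)
    (hWL : W ≤ Real.log N) (hNX : N ≤ X) (hX : X ≤ 2 * W * N) :
    1 + Real.log (2 * X) ≤ Real.log N ^ 3 := by
  have hlogN := Real.log_le_sub_one_of_pos (show 0 < N by linarith)
  have h : 2 * X ≤ N ^ 3 := by
    have : 4 * W ≤ N ^ 2 := by nlinarith
    nlinarith
  have h2 := Real.log_le_log (by linarith) h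
  rw [Real.log_pow] at h2
  push_cast at h2
  nlinarith [mul_nonneg (show 0 ≤ Real.log N - 2 by linarith) (sq_nonneg (Real.log N))]

lemma natDegree_map_intCast_mul (ψ : Polynomial ℤ) (α : ℝ) :
    (Polynomial.C α * ψ.map (Int.castRingHom ℝ)).natDegree ≤ ψ.natDegree :=
  (Polynomial.natDegree_C_mul_le _ _).trans Polynomial.natDegree_map_le

/-- Minor-arc estimate: for every `A > 0` and `k ≥ 1` there is `B = B(A,k) > 0`
such that for every polynomial `ψ` of degree `k` with integer coefficients and
positive leading coefficient `a₁` there is `C = C(A,k,ψ) > 0` with: for all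
coprime positive integers `b ≤ W`, all `N ≥ e^{a₁ W^k}`, and all `α` with
`|α − a/q| ≤ q⁻²` for some `1 ≤ a ≤ q`, `gcd(a,q) = 1`,
`(log N)^B ≤ q ≤ ψ(N)(log N)^{−B}`, one has
`|Σ_{x=1}^{N} λ_{b,W}(x) e(α ψ(x))| ≤ C N (log N)^{−A}`. -/
theorem minor_arc_estimate (A : ℝ) (hA : 0 < A) (k : ℕ) (hk : 1 ≤ k) :
    ∃ B : ℝ, 0 < B ∧
    ∀ ψ : Polynomial ℤ, ψ.natDegree = k → 0 < ψ.leadingCoeff →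
    ∃ C : ℝ, 0 < C ∧
    ∀ b W : ℕ, 1 ≤ b → b ≤ W → Nat.gcd b W = 1 →
    ∀ N : ℕ, Real.exp ((ψ.leadingCoeff : ℝ) * (W : ℝ) ^ k) ≤ (N : ℝ) →
    ∀ a q : ℕ, 1 ≤ a → a ≤ q → Nat.gcd a q = 1 →
      Real.log N ^ (B : ℝ) ≤ (q : ℝ) →
      (q : ℝ) ≤ ((ψ.eval (N : ℤ) : ℤ) : ℝ) * Real.log N ^ (-B : ℝ) →
    ∀ α : ℝ, |α - (a : ℝ) / q| ≤ ((q : ℝ) ^ 2)⁻¹ →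
    ‖∑ x ∈ Finset.Icc 1 N, (lam b W x : ℂ) * eC (α * ((ψ.eval (x : ℤ) : ℤ) : ℝ))‖
      ≤ C * N * Real.log N ^ (-A : ℝ) := by
  obtain ⟨k', rfl⟩ : ∃ k', k = k' + 1 := ⟨k - 1, by omega⟩
  obtain ⟨C, hC⟩ := vonMangoldt_inverse k'
  set A' := ⌈A⌉₊ with hA'
  have hAA' : A ≤ A' := Nat.le_ceil A
  set E := A' + 3 with hE
  refine ⟨((E * C + 3 : ℕ) : ℝ), by positivity, fun ψ hdeg hlead => ?_⟩
  set cψ : ℝ := ∑ i ∈ range (ψ.natDegree + 1), |(ψ.coeff i : ℝ)| with hcψ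
  obtain ⟨a₁, ha₁⟩ := Int.eq_ofNat_of_zero_le hlead.le
  have ha₁pos : 1 ≤ a₁ := by omega
  obtain ⟨N₀, hN₀⟩ := exists_log_threshold
    (2 + ((k' + 1).factorial * a₁ : ℕ) + cψ) (E * C + 2 * (A' + 7))
  have hcψ0 : 0 ≤ cψ := sum_nonneg fun _ _ => abs_nonneg _
  refine ⟨1 + 3 * (N₀ : ℝ) ^ (1 + A), by positivity, ?_⟩
  intro b W hb hbW hgcd N hN a q ha haq hgcd' hqlow hqup α hα
  rw [Real.rpow_natCast] at hqlow
  rw [Real.rpow_neg_eq_inv_rpow, Real.rpow_natCast, inv_pow, ← div_eq_mul_inv] at hqup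
  have hWpos : 1 ≤ W := hb.trans hbW
  have hW1 : (1 : ℝ) ≤ W := by exact_mod_cast hWpos
  have hN0 : (0 : ℝ) < N := (Real.exp_pos _).trans_le hN
  have hWL : (W : ℝ) ≤ Real.log N := by
    rw [← Real.le_log_iff_exp_le hN0] at hN
    refine le_trans ?_ hN
    have h1 : (W : ℝ) ≤ (W : ℝ) ^ (k' + 1) := le_self_pow₀ hW1 (by omega)
    have h2 : (1 : ℝ) ≤ (ψ.leadingCoeff : ℝ) := by exact_mod_cast hlead
    nlinarith
  have hlogN := Real.log_le_sub_one_of_pos hN0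
  have hL1 : 1 ≤ Real.log N := hW1.trans hWL
  have hN2 : 2 ≤ N := by
    have : (2 : ℝ) ≤ N := by linarith
    exact_mod_cast this
  have hWN : W ≤ N := by
    have : (W : ℝ) ≤ N := by linarith
    exact_mod_cast this
  have hLA : 0 ≤ Real.log N ^ (-A : ℝ) := Real.rpow_nonneg (by linarith) _
  rcases lt_or_ge N N₀ with hlt | hge
  · refine (norm_sum_lam_le_trivial hb hbW hWN hN2 _).trans ?_
    have h1 : Real.log N = Real.log N ^ (1 + A) * Real.log N ^ (-A : ℝ) := by
      rw [← Real.rpow_add (by linarith), add_neg_cancel_right, Real.rpow_one]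
    have h2 : Real.log N ^ (1 + A) ≤ (N₀ : ℝ) ^ (1 + A) := by
      have : (N : ℝ) ≤ N₀ := by exact_mod_cast hlt.le
      exact Real.rpow_le_rpow (by linarith) (by linarith) (by linarith)
    calc 3 * N * Real.log N = 3 * N * (Real.log N ^ (1 + A) * Real.log N ^ (-A : ℝ)) := by
          rw [← h1]
      _ ≤ 3 * N * ((N₀ : ℝ) ^ (1 + A) * Real.log N ^ (-A : ℝ)) := by gcongr
      _ = (3 * (N₀ : ℝ) ^ (1 + A)) * N * Real.log N ^ (-A : ℝ) := by ring
      _ ≤ _ := by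
        gcongr
        linarith
  obtain ⟨hLc, hLm⟩ := hN₀ N hge
  have hfa : (1 : ℝ) ≤ ((k' + 1).factorial * a₁ : ℕ) := by
    exact_mod_cast Nat.mul_pos (Nat.factorial_pos _) ha₁pos
  have hcL : cψ ≤ Real.log N := by linarith
  have hL2 : 2 ≤ Real.log N := by linarith
  have hfL : (((k' + 1).factorial * a₁ : ℕ) : ℝ) ≤ Real.log N := by linarith
  suffices h : ‖∑ x ∈ Finset.Icc 1 N, (lam b W x : ℂ) * eC (α * ((ψ.eval (x : ℤ) : ℤ) : ℝ))‖
      ≤ N / Real.log N ^ A' by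
    refine h.trans ?_
    calc (N : ℝ) / Real.log N ^ A' = 1 * N * Real.log N ^ (-(A' : ℝ)) := by
          rw [Real.rpow_neg (by linarith), Real.rpow_natCast, one_mul, div_eq_mul_inv]
      _ ≤ (1 + 3 * (N₀ : ℝ) ^ (1 + A)) * N * Real.log N ^ (-A : ℝ) := by
        gcongr
        · have : 0 ≤ (N₀ : ℝ) ^ (1 + A) := by positivity
          linarith
  by_contra! hbig
  set P := Polynomial.C α * ψ.map (Int.castRingHom ℝ) with hP
  have hphase := polyPhase_eval (k' + 1) P ((natDegree_map_intCast_mul ψ α).trans hdeg.le)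
  have heval : ∀ x : ℕ, P.eval (x : ℝ) = α * ((ψ.eval (x : ℤ) : ℤ) : ℝ) := by
    intro x
    rw [hP, Polynomial.eval_C_mul, ← Int.cast_natCast, Polynomial.eval_intCast_map]
    simp
  simp_rw [← heval] at hbig
  have hupper := norm_sum_lam_le hb hbW N (fun x => P.eval x)
  set X := W * N + b with hXdef
  have hNXnat : N ≤ X := by
    have := Nat.mul_le_mul_right N hWpos
    omega
  have hXle : X ≤ 2 * W * N := by
    have : W ≤ W * N := Nat.le_mul_of_pos_right W (by omega)
    have : 2 * W * N = W * N + W * N := by ring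
    omega
  have hNX : (N : ℝ) ≤ X := by exact_mod_cast hNXnat
  have hXle' : (X : ℝ) ≤ 2 * W * N := by exact_mod_cast hXle
  have hN1 : (1 : ℝ) ≤ N := by linarith
  have hdiv := div_pow_log_le A' hN1 hL2 hW1 hWL hNX hXle'
    ((pow_le_pow_right₀ hL1 (by omega)).trans hLm)
  have hlog2 := one_add_log_two_mul_le hN1 hL2 hWL hNX hXle'
  have hKC : (Real.log N ^ E) ^ C ≤ N := by
    rw [← pow_mul]
    exact (pow_le_pow_right₀ hL1 (by omega)).trans hLm
  obtain ⟨Q, hQ1, hQK, hQ⟩ := hC (Real.log N ^ E) (hL2.trans (le_self_pow₀ hL1 (by omega)))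
    _ _ hphase b W hWpos hgcd X (hlog2.trans (pow_le_pow_right₀ hL1 (by omega)))
    (hKC.trans hNX) (by linarith)
  have hβ : (Q : ℝ) * ((k' + 1).factorial * P.coeff (k' + 1)) =
      ((Q * ((k' + 1).factorial * a₁) : ℕ) : ℝ) * α := by
    have hcoeff : P.coeff (k' + 1) = α * a₁ := by
      rw [hP, Polynomial.coeff_C_mul, Polynomial.coeff_map, ← hdeg, Polynomial.coeff_natDegree, ha₁]
      simp
    rw [hcoeff]
    push_cast
    ring
  rw [hβ] at hQ
  rw [← pow_mul] at hQK hQ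
  set L := Real.log N with hL
  have hRq : 2 * (Q * ((k' + 1).factorial * a₁)) ≤ q := by
    have : 2 * ((Q : ℝ) * ((k' + 1).factorial * a₁ : ℕ)) ≤ q := by
      refine le_trans ?_ hqlow
      calc 2 * ((Q : ℝ) * ((k' + 1).factorial * a₁ : ℕ)) ≤ L * (L ^ (E * C) * L) := by gcongr
        _ = L ^ (E * C + 2) := by ring
        _ ≤ L ^ (E * C + 3) := pow_le_pow_right₀ hL1 (by omega)
    exact_mod_cast this
  have hone := one_le_of_nearInt hgcd'
    (Nat.mul_pos hQ1 (Nat.mul_pos (Nat.factorial_pos _) ha₁pos)) hRq hα hQ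
  have hψ := eval_le_sum_abs_coeff_mul ψ (N := N) (by omega)
  rw [hdeg] at hψ
  have hq : (q : ℝ) ≤ L * N ^ (k' + 1) / L ^ (E * C + 3) := by
    refine hqup.trans ?_
    gcongr
    refine hψ.trans ?_
    rw [hcψ, hdeg] at hcL
    gcongr
  have hfinal : 2 * (q : ℝ) * (L ^ (E * C) / (X : ℝ) ^ (k' + 1)) ≤ 2 / L ^ 2 := by
    calc 2 * (q : ℝ) * (L ^ (E * C) / (X : ℝ) ^ (k' + 1)) ≤
        2 * (L * N ^ (k' + 1) / L ^ (E * C + 3)) * (L ^ (E * C) / (N : ℝ) ^ (k' + 1)) := by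
          gcongr
      _ = 2 / L ^ 2 := by
        have : L ≠ 0 := by linarith
        field_simp
        ring
  have : 2 / L ^ 2 < 1 := by
    rw [div_lt_one (by positivity)]
    nlinarith
  linarith
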